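/- There exist universal constants C > 0 and c > 0 with the following property. Let G : ℝ^s → ℝ^n be a d-layer feedforward neural network with at most N nodes per layer, all weights bounded by w_max in absolute value, and 1-Lipschitz activations. Fix ε ∈ (0,1), R_min > 0, r > 0, and τ₁, τ₂ ≥ 0. Let A ∈ ℝ^{m×n} be a random matrix with i.i.d. standard Gaussian N(0,1) entries. If m ≥ C s ε^{−2} log( r (N w_max)^d / (R_min ε) ), then with probability at least 1 − exp(−c ε² m) over A, the following holds: for every x* ∈ G(B_r^s) with ‖x*‖ > R_min, every y ∈ {±1}^m with d_H(y, sign(A x*)) ≤ τ₁, and every x̂ ∈ G(B_r^s) with ‖x̂‖ > R_min and d_H(sign(A x̂), y) ≤ τ₂, one has d_s(x̂, x*) ≤ ε + τ₁ + τ₂. -/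

import Mathlib

open MeasureTheory ProbabilityTheory

noncomputable section

/-- Euclidean norm on `Fin n → ℝ`. -/
def evNorm {n : ℕ} (x : Fin n → ℝ) : ℝ := Real.sqrt (∑ i, x i ^ 2)

/-- Euclidean inner product on `Fin n → ℝ`. -/
def evInner {n : ℕ} (u v : Fin n → ℝ) : ℝ := ∑ i, u i * v i

/-- The sign function: `+1` if `p > 0` and `-1` if `p ≤ 0`. -/
def sgn (p : ℝ) : ℝ := if 0 < p then 1 else -1

/-- The law of a standard Gaussian random vector in `ℝ^n` (i.i.d. `N(0,1)` coordinates). -/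
def stdGaussianVec (n : ℕ) : Measure (Fin n → ℝ) :=
  Measure.pi fun _ => gaussianReal 0 1

/-- The law of an `m × n` random matrix with i.i.d. `N(0,1)` entries; `A i` is the `i`-th row. -/
def stdGaussianMatrix (m n : ℕ) : Measure (Fin m → Fin n → ℝ) :=
  Measure.pi fun _ => stdGaussianVec n

/-- `φ : ℝ^p → ℝ^q` is a neural-network layer with at most `N` nodes, all weights bounded
by `wmax` in absolute value, and an `L`-Lipschitz activation map:
`φ(v) = σ(W v + b)`. -/
def IsLayer (L wmax : ℝ) (N : ℕ) {p q : ℕ} (φ : (Fin p → ℝ) → (Fin q → ℝ)) : Prop :=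
  p ≤ N ∧ q ≤ N ∧
    ∃ (W : Fin q → Fin p → ℝ) (b : Fin q → ℝ) (σ : (Fin q → ℝ) → (Fin q → ℝ)),
      (∀ j k, |W j k| ≤ wmax) ∧
      (∀ v v', evNorm (σ v - σ v') ≤ L * evNorm (v - v')) ∧
      (∀ v, φ v = σ (fun j => (∑ k, W j k * v k) + b j))

/-- `IsMLP L wmax N d s n G` : `G : ℝ^s → ℝ^n` is a `d`-layer feedforward neural network with
at most `N` nodes per layer, all weights bounded by `wmax` in absolute value, and
`L`-Lipschitz activations. -/
inductive IsMLP (L wmax : ℝ) (N : ℕ) : ∀ (d s n : ℕ), ((Fin s → ℝ) → (Fin n → ℝ)) → Prop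
  | single {s n : ℕ} {φ : (Fin s → ℝ) → (Fin n → ℝ)} (h : IsLayer L wmax N φ) :
      IsMLP L wmax N 1 s n φ
  | comp {d s p n : ℕ} {G : (Fin s → ℝ) → (Fin p → ℝ)} {φ : (Fin p → ℝ) → (Fin n → ℝ)}
      (hG : IsMLP L wmax N d s p G) (hφ : IsLayer L wmax N φ) :
      IsMLP L wmax N (d + 1) s n (fun z => φ (G z))

/-- Normalized Hamming distance `d_H(u,v) = (1/m) |{i : u i ≠ v i}|`. -/
def hamDist {m : ℕ} (u v : Fin m → ℝ) : ℝ :=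
  ((Finset.univ.filter fun i => u i ≠ v i).card : ℝ) / (m : ℝ)

/-- Geodesic distance `d_s(u,v) = (1/π) arccos(⟨u,v⟩ / (‖u‖‖v‖))`. -/
def geodesicDist {n : ℕ} (u v : Fin n → ℝ) : ℝ :=
  (1 / Real.pi) * Real.arccos (evInner u v / (evNorm u * evNorm v))

lemma gaussianReal_prod_eq_withDensity :
    (gaussianReal 0 1).prod (gaussianReal 0 1) =
      (volume : Measure (ℝ × ℝ)).withDensity
        (fun p => ENNReal.ofReal ((2 * Real.pi)⁻¹ * Real.exp (-(p.1 ^ 2 + p.2 ^ 2) / 2))) := by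
  have h1 : (gaussianReal 0 1) = volume.withDensity (gaussianPDF 0 1) :=
    gaussianReal_of_var_ne_zero 0 one_ne_zero
  have : IsFiniteMeasure ((volume : Measure ℝ).withDensity (gaussianPDF 0 1)) := by
    rw [← h1]; infer_instance
  rw [h1, prod_withDensity (measurable_gaussianPDF 0 1) (measurable_gaussianPDF 0 1)]
  rw [Measure.volume_eq_prod]
  congr 1
  ext p
  rw [gaussianPDF, gaussianPDF, ← ENNReal.ofReal_mul (gaussianPDFReal_nonneg _ _ _)]
  congr 1
  simp only [gaussianPDFReal, sub_zero, NNReal.coe_one, mul_one]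
  rw [mul_mul_mul_comm, ← Real.exp_add, ← mul_inv, Real.mul_self_sqrt (by positivity)]
  congr 2
  ring

/-- The standard Gaussian measure of a planar set containing a sector. -/
lemma gaussianReal_prod_sector {D : Set (ℝ × ℝ)} (hD : MeasurableSet D) {α β : ℝ}
    (hα : -Real.pi ≤ α) (hαβ : α ≤ β) (hβ : β ≤ Real.pi)
    (h : ∀ r φ, 0 < r → α < φ → φ < β → (r * Real.cos φ, r * Real.sin φ) ∈ D) :
    (β - α) / (2 * Real.pi) ≤ ((gaussianReal 0 1).prod (gaussianReal 0 1)).real D := by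
  set g : ℝ → ENNReal := fun r =>
    ENNReal.ofReal r * ENNReal.ofReal ((2 * Real.pi)⁻¹ * Real.exp (-(r ^ 2) / 2)) with hg
  have hgm : Measurable g := by fun_prop
  set K := ∫⁻ r in Set.Ioi (0 : ℝ), g r with hK
  have key : ∀ D : Set (ℝ × ℝ), MeasurableSet D →
      ((gaussianReal 0 1).prod (gaussianReal 0 1)) D =
        ∫⁻ p in Set.Ioi (0 : ℝ) ×ˢ Set.Ioo (-Real.pi) Real.pi,
          D.indicator (fun _ => (1 : ENNReal)) (p.1 * Real.cos p.2, p.1 * Real.sin p.2) * g p.1 := by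
    intro D hD
    rw [gaussianReal_prod_eq_withDensity, withDensity_apply _ hD, ← lintegral_indicator hD,
      ← lintegral_comp_polarCoord_symm]
    refine setLIntegral_congr_fun (polarCoord.open_target.measurableSet) ?_
    intro p _
    have hsq : (p.1 * Real.cos p.2) ^ 2 + (p.1 * Real.sin p.2) ^ 2 = p.1 ^ 2 := by
      linear_combination p.1 ^ 2 * Real.sin_sq_add_cos_sq p.2
    by_cases hp : (p.1 * Real.cos p.2, p.1 * Real.sin p.2) ∈ D <;>
      simp only [polarCoord_symm_apply, smul_eq_mul, hg, Set.indicator, hp, if_true, if_false,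
        one_mul, zero_mul, mul_zero, hsq]
  have hrect : ∀ a b : ℝ, ∫⁻ p in Set.Ioi (0 : ℝ) ×ˢ Set.Ioo a b, g p.1
      = K * ENNReal.ofReal (b - a) := by
    intro a b
    rw [Measure.volume_eq_prod, ← Measure.prod_restrict,
      lintegral_prod _ (by fun_prop)]
    simp only [lintegral_const, Measure.restrict_apply_univ, Real.volume_Ioo]
    rw [lintegral_mul_const _ hgm]
  have htot : K * ENNReal.ofReal (2 * Real.pi) = 1 := by
    have := key Set.univ MeasurableSet.univ
    simp only [Set.indicator_univ, one_mul, measure_univ] at this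
    rw [hrect] at this
    rw [this]; congr 2; ring
  have hle : K * ENNReal.ofReal (β - α) ≤ ((gaussianReal 0 1).prod (gaussianReal 0 1)) D := by
    rw [key D hD, ← hrect]
    calc ∫⁻ p in Set.Ioi (0 : ℝ) ×ˢ Set.Ioo α β, g p.1
        = ∫⁻ p in Set.Ioi (0 : ℝ) ×ˢ Set.Ioo α β,
          D.indicator (fun _ => (1 : ENNReal)) (p.1 * Real.cos p.2, p.1 * Real.sin p.2) * g p.1 := by
          refine setLIntegral_congr_fun (measurableSet_Ioi.prod measurableSet_Ioo) ?_
          rintro ⟨r, φ⟩ ⟨hr, hφ⟩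
          simp only
          rw [Set.indicator_of_mem (h r φ hr hφ.1 hφ.2), one_mul]
      _ ≤ _ := lintegral_mono_set (Set.prod_mono_right (Set.Ioo_subset_Ioo hα hβ))
  have hKr : K.toReal * (2 * Real.pi) = 1 := by
    have := congrArg ENNReal.toReal htot
    rwa [ENNReal.toReal_mul, ENNReal.toReal_ofReal (by positivity), ENNReal.toReal_one] at this
  have := ENNReal.toReal_mono (measure_ne_top _ _) hle
  rw [ENNReal.toReal_mul, ENNReal.toReal_ofReal (by linarith)] at this
  rw [Measure.real]
  refine le_trans (le_of_eq ?_) this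
  have hpi := Real.pi_pos
  rw [div_eq_iff (by positivity)]
  linear_combination (-(β - α)) * hKr

variable {F : Type*} [NormedAddCommGroup F] [InnerProductSpace ℝ F] [FiniteDimensional ℝ F]
  [MeasurableSpace F] [BorelSpace F]

lemma stdGaussian_map_inner (x : F) :
    (stdGaussian F).map (fun a => inner ℝ x a) = gaussianReal 0 (‖x‖₊ ^ 2) := by
  have := IsGaussian.map_eq_gaussianReal (μ := stdGaussian F) (innerSL ℝ x)
  rw [integral_strongDual_stdGaussian, variance_dual_stdGaussian, innerSL_apply_norm] at this
  convert this using 2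
  · ext; simp
  · rw [Real.toNNReal_pow (norm_nonneg x), norm_toNNReal]

lemma stdGaussian_map_inner_pair {x y : F} (hx : ‖x‖ = 1) (hy : ‖y‖ = 1) {θ : ℝ}
    (hθ : inner ℝ x y = Real.cos θ) :
    (stdGaussian F).map (fun a => ((inner ℝ x a, inner ℝ y a) : ℝ × ℝ)) =
      ((gaussianReal 0 1).prod (gaussianReal 0 1)).map
        (fun p => (p.1, Real.cos θ * p.1 + Real.sin θ * p.2)) := by
  have e1 : (fun a => ((inner ℝ x a, inner ℝ y a) : ℝ × ℝ)) = ⇑((innerSL ℝ x).prod (innerSL ℝ y)) := by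
    ext a <;> simp
  have e2 : (fun p : ℝ × ℝ => (p.1, Real.cos θ * p.1 + Real.sin θ * p.2)) =
      ⇑((ContinuousLinearMap.fst ℝ ℝ ℝ).prod
        (Real.cos θ • ContinuousLinearMap.fst ℝ ℝ ℝ +
          Real.sin θ • ContinuousLinearMap.snd ℝ ℝ ℝ)) := by
    ext p <;> simp
  rw [e1, e2]
  have : IsProbabilityMeasure ((stdGaussian F).map ⇑((innerSL ℝ x).prod (innerSL ℝ y))) :=
    Measure.isProbabilityMeasure_map (by fun_prop)
  have : IsProbabilityMeasure (((gaussianReal 0 1).prod (gaussianReal 0 1)).map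
      ⇑((ContinuousLinearMap.fst ℝ ℝ ℝ).prod
        (Real.cos θ • ContinuousLinearMap.fst ℝ ℝ ℝ +
          Real.sin θ • ContinuousLinearMap.snd ℝ ℝ ℝ))) :=
    Measure.isProbabilityMeasure_map (by fun_prop)
  apply Measure.ext_of_charFunDual
  ext L
  rw [charFunDual_map, charFunDual_map, charFunDual_stdGaussian, charFunDual_prod]
  set a := L (1, 0)
  set b := L (0, 1)
  have hL : ∀ u v : ℝ, L (u, v) = u * a + v * b := by
    intro u v
    have : ((u, v) : ℝ × ℝ) = u • (1, 0) + v • (0, 1) := by ext <;> simp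
    rw [this, map_add, map_smul, map_smul]; rfl
  have hn : L.comp ((innerSL ℝ x).prod (innerSL ℝ y)) = innerSL ℝ (a • x + b • y) := by
    ext v
    simp [hL]
    ring
  rw [hn, innerSL_apply_norm]
  have hns : ‖a • x + b • y‖ ^ 2 = a ^ 2 + b ^ 2 + 2 * a * b * Real.cos θ := by
    rw [norm_add_sq_real, norm_smul, norm_smul, hx, hy, inner_smul_left, inner_smul_right, hθ]
    simp
    ring
  have c1 : ∀ M : StrongDual ℝ ℝ, charFunDual (gaussianReal 0 1) M =
      Complex.exp (-((M 1 : ℝ) : ℂ) ^ 2 / 2) := by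
    intro M
    have : charFunDual (gaussianReal 0 1) M = charFun (gaussianReal 0 1) (M 1) := by
      rw [charFunDual_apply, charFun_apply_real]
      congr with v
      have : M v = M 1 * v := by
        rw [← smul_eq_mul v 1 |>.trans (mul_one v), map_smul, smul_eq_mul, mul_comm]; simp
      rw [this]; push_cast; rfl
    rw [this, charFun_gaussianReal]
    congr 1
    simp
    ring
  rw [c1, c1, ← Complex.exp_add]
  congr 1
  have h2 := Real.sin_sq_add_cos_sq θ
  rw [← Complex.ofReal_pow, hns]
  simp only [ContinuousLinearMap.comp_apply, ContinuousLinearMap.inl_apply,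
    ContinuousLinearMap.inr_apply, ContinuousLinearMap.prod_apply, hL]
  push_cast
  have h2' : (Complex.sin θ) ^ 2 + (Complex.cos θ) ^ 2 = 1 := Complex.sin_sq_add_cos_sq _
  simp
  linear_combination (((b : ℂ) ^ 2) / 2) * h2'

/-- For standard Gaussian `a`, the marginals `⟨x,a⟩ > 0` and `⟨y,a⟩ < 0` hold together with
probability at least `angle x y / 2π`. -/
lemma angle_le_stdGaussian_real {x y : F} (hx : x ≠ 0) (hy : y ≠ 0) :
    InnerProductGeometry.angle x y / (2 * Real.pi) ≤
      (stdGaussian F).real {a | 0 < inner ℝ x a ∧ inner ℝ y a < 0} := by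
  have hx' : 0 < ‖x‖ := norm_pos_iff.2 hx
  have hy' : 0 < ‖y‖ := norm_pos_iff.2 hy
  set u := ‖x‖⁻¹ • x with hu
  set v := ‖y‖⁻¹ • y with hv
  have hu1 : ‖u‖ = 1 := norm_smul_inv_norm hx
  have hv1 : ‖v‖ = 1 := norm_smul_inv_norm hy
  set θ := InnerProductGeometry.angle x y with hθ
  have hθ' : inner ℝ u v = Real.cos θ := by
    rw [hθ, InnerProductGeometry.cos_angle, hu, hv, inner_smul_left, inner_smul_right]
    simp
    field_simp
  have hset : {a : F | 0 < inner ℝ x a ∧ inner ℝ y a < 0} =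
      (fun a => ((inner ℝ u a, inner ℝ v a) : ℝ × ℝ)) ⁻¹' {p | 0 < p.1 ∧ p.2 < 0} := by
    ext a
    simp only [Set.mem_ofPred_eq, Set.mem_preimage, hu, hv, real_inner_smul_left]
    have hn : ∀ t : ℝ, ‖y‖⁻¹ * t < 0 ↔ t < 0 := fun t => by
      rw [← neg_pos, ← mul_neg, mul_pos_iff_of_pos_left (inv_pos.2 hy'), neg_pos]
    rw [mul_pos_iff_of_pos_left (inv_pos.2 hx'), hn]
  have hm : MeasurableSet {p : ℝ × ℝ | 0 < p.1 ∧ p.2 < 0} :=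
    (measurableSet_lt measurable_const measurable_fst).inter
      (measurableSet_lt measurable_snd measurable_const)
  rw [hset, ← map_measureReal_apply (by fun_prop) hm, stdGaussian_map_inner_pair hu1 hv1 hθ',
    map_measureReal_apply (by fun_prop) hm]
  have h0 : 0 ≤ θ := InnerProductGeometry.angle_nonneg _ _
  have h1 : θ ≤ Real.pi := InnerProductGeometry.angle_le_pi _ _
  have hpi := Real.pi_pos
  refine le_trans (le_of_eq ?_) (gaussianReal_prod_sector (α := -(Real.pi / 2))
    (β := θ - Real.pi / 2) ?_ (by linarith) (by linarith) (by linarith) ?_)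
  · ring
  · exact (by fun_prop : Measurable fun p : ℝ × ℝ =>
      (p.1, Real.cos θ * p.1 + Real.sin θ * p.2)) hm
  · intro r φ hr hφ1 hφ2
    simp only [Set.mem_preimage, Set.mem_ofPred_eq]
    refine ⟨mul_pos hr (Real.cos_pos_of_mem_Ioo ⟨hφ1, by linarith⟩), ?_⟩
    have : Real.cos θ * (r * Real.cos φ) + Real.sin θ * (r * Real.sin φ) =
        r * Real.cos (θ - φ) := by rw [Real.cos_sub]; ring
    rw [this]
    refine mul_neg_of_pos_of_neg hr (Real.cos_neg_of_pi_div_two_lt_of_lt ?_ ?_) <;> linarith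

/-- Anti-concentration of a one-dimensional marginal. -/
lemma stdGaussian_real_abs_inner_le {x : F} (hx : 1 / 2 ≤ ‖x‖) {κ : ℝ} (hκ : 0 ≤ κ) :
    (stdGaussian F).real {a | |inner ℝ x a| ≤ κ} ≤ 2 * κ := by
  have hv : (‖x‖₊ ^ 2 : NNReal) ≠ 0 := by
    have : (0 : ℝ) < ‖x‖ := by linarith
    simpa using norm_pos_iff.1 this
  have hset : {a : F | |inner ℝ x a| ≤ κ} = (fun a => inner ℝ x a) ⁻¹' (Set.Icc (-κ) κ) := by
    ext a; simp [abs_le]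
  rw [hset, ← map_measureReal_apply (by fun_prop) measurableSet_Icc, stdGaussian_map_inner,
    Measure.real, gaussianReal_apply_eq_integral _ hv]
  have hpi := Real.pi_gt_three
  have hb : ∀ t : ℝ, gaussianPDFReal 0 (‖x‖₊ ^ 2) t ≤ 1 := by
    intro t
    rw [gaussianPDFReal]
    have h1 : (1 : ℝ) ≤ √(2 * Real.pi * ((‖x‖₊ ^ 2 : NNReal) : ℝ)) := by
      rw [Real.one_le_sqrt]
      push_cast
      nlinarith
    have h2 : Real.exp (-(t - 0) ^ 2 / (2 * ((‖x‖₊ ^ 2 : NNReal) : ℝ))) ≤ 1 := by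
      rw [Real.exp_le_one_iff, neg_div]
      have : 0 ≤ (t - 0) ^ 2 / (2 * ((‖x‖₊ ^ 2 : NNReal) : ℝ)) := by positivity
      linarith
    calc _ ≤ (1 : ℝ) * 1 := mul_le_mul (inv_le_one_of_one_le₀ h1) h2 (Real.exp_nonneg _) zero_le_one
      _ = 1 := one_mul 1
  rw [ENNReal.toReal_ofReal (integral_nonneg fun t => gaussianPDFReal_nonneg _ _ t)]
  calc ∫ t in Set.Icc (-κ) κ, gaussianPDFReal 0 (‖x‖₊ ^ 2) t
      ≤ ∫ t in Set.Icc (-κ) κ, (1 : ℝ) :=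
        setIntegral_mono ((integrable_gaussianPDFReal _ _).integrableOn)
          (by simp) hb
    _ = 2 * κ := by
      simp [Real.volume_real_Icc]
      rw [max_eq_left (by linarith)]; ring

/-- The set of measurement vectors that separate `x` and `y` with margin `κ`. -/
def marginSet (x y : F) (κ : ℝ) : Set F :=
  {a | (κ < inner ℝ x a ∧ inner ℝ y a < -κ) ∨ (inner ℝ x a < -κ ∧ κ < inner ℝ y a)}

lemma measurableSet_marginSet (x y : F) (κ : ℝ) : MeasurableSet (marginSet x y κ) := by
  have hx : Measurable (fun a : F => inner ℝ x a) := by fun_prop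
  have hy : Measurable (fun a : F => inner ℝ y a) := by fun_prop
  exact ((measurableSet_lt measurable_const hx).inter (measurableSet_lt hy measurable_const)).union
    ((measurableSet_lt hx measurable_const).inter (measurableSet_lt measurable_const hy))

lemma angle_sub_le_real_marginSet {x y : F} (hx : 1 / 2 ≤ ‖x‖) (hy : 1 / 2 ≤ ‖y‖) {κ : ℝ}
    (hκ : 0 ≤ κ) :
    InnerProductGeometry.angle x y / Real.pi - 4 * κ ≤ (stdGaussian F).real (marginSet x y κ) := by
  have hx0 : x ≠ 0 := by rintro rfl; norm_num at hx
  have hy0 : y ≠ 0 := by rintro rfl; norm_num at hy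
  have h1 := angle_le_stdGaussian_real hx0 hy0
  have h2 := angle_le_stdGaussian_real hy0 hx0
  rw [InnerProductGeometry.angle_comm] at h2
  have h3 := stdGaussian_real_abs_inner_le hx hκ
  have h4 := stdGaussian_real_abs_inner_le hy hκ
  set P := (stdGaussian F).real with hP
  have hmx : Measurable (fun a : F => inner ℝ x a) := by fun_prop
  have hmy : Measurable (fun a : F => inner ℝ y a) := by fun_prop
  have hU : P ({a | 0 < inner ℝ x a ∧ inner ℝ y a < 0} ∪ {a | 0 < inner ℝ y a ∧ inner ℝ x a < 0}) =
      P {a | 0 < inner ℝ x a ∧ inner ℝ y a < 0} + P {a | 0 < inner ℝ y a ∧ inner ℝ x a < 0} := by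
    refine measureReal_union ?_ ?_
    · rw [Set.disjoint_left]
      rintro a ⟨ha, _⟩ ⟨_, hb⟩
      exact lt_asymm ha hb
    · exact (measurableSet_lt measurable_const hmy).inter (measurableSet_lt hmx measurable_const)
  have hsub : {a | 0 < inner ℝ x a ∧ inner ℝ y a < 0} ∪ {a | 0 < inner ℝ y a ∧ inner ℝ x a < 0} ⊆
      marginSet x y κ ∪ ({a | |inner ℝ x a| ≤ κ} ∪ {a | |inner ℝ y a| ≤ κ}) := by
    intro a ha
    simp only [marginSet, Set.mem_union, Set.mem_ofPred_eq, abs_le] at ha ⊢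
    grind
  have h5 := measureReal_mono (μ := stdGaussian F) hsub
  have h6 := measureReal_union_le (μ := stdGaussian F) (marginSet x y κ)
    ({a | |inner ℝ x a| ≤ κ} ∪ {a | |inner ℝ y a| ≤ κ})
  have h7 := measureReal_union_le (μ := stdGaussian F)
    {a | |inner ℝ x a| ≤ κ} {a | |inner ℝ y a| ≤ κ}
  rw [← hP] at h5 h6 h7
  have h8 : InnerProductGeometry.angle x y / Real.pi =
      InnerProductGeometry.angle x y / (2 * Real.pi) +
        InnerProductGeometry.angle x y / (2 * Real.pi) := by
    have := Real.pi_pos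
    field_simp; ring
  linarith

lemma integral_exp_abs_inner_le {u : F} (hu : ‖u‖ ≤ 1) :
    Integrable (fun a => Real.exp |inner ℝ u a|) (stdGaussian F) ∧
      ∫ a, Real.exp |inner ℝ u a| ∂(stdGaussian F) ≤ Real.exp 2 := by
  have hmap := stdGaussian_map_inner u
  have key : ∀ t : ℝ, (t = 1 ∨ t = -1) →
      Integrable (fun a => Real.exp (t * inner ℝ u a)) (stdGaussian F) ∧
      ∫ a, Real.exp (t * inner ℝ u a) ∂(stdGaussian F) ≤ Real.exp (1 / 2) := by
    intro t ht
    constructor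
    · have := integrable_exp_mul_gaussianReal (μ := 0) (v := ‖u‖₊ ^ 2) t
      rw [← hmap, integrable_map_measure (by fun_prop) (by fun_prop)] at this
      exact this
    · have := mgf_gaussianReal hmap t
      rw [mgf] at this
      rw [this]
      apply Real.exp_le_exp.2
      have ht2 : t ^ 2 = 1 := by rcases ht with rfl | rfl <;> norm_num
      rw [ht2]
      push_cast
      nlinarith [norm_nonneg u]
  obtain ⟨i1, e1⟩ := key 1 (Or.inl rfl)
  obtain ⟨i2, e2⟩ := key (-1) (Or.inr rfl)
  have hle : ∀ a : F, Real.exp |inner ℝ u a| ≤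
      Real.exp (1 * inner ℝ u a) + Real.exp (-1 * inner ℝ u a) := by
    intro a
    rcases abs_choice (inner ℝ u a) with h | h <;> rw [h]
    · rw [one_mul]; linarith [Real.exp_pos (-1 * inner ℝ u a)]
    · rw [neg_one_mul]; linarith [Real.exp_pos (1 * inner ℝ u a)]
  have hI : Integrable (fun a => Real.exp |inner ℝ u a|) (stdGaussian F) := by
    refine (i1.add i2).mono' (by fun_prop) (Filter.Eventually.of_forall fun a => ?_)
    rw [Real.norm_of_nonneg (Real.exp_nonneg _)]
    exact hle a
  refine ⟨hI, ?_⟩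
  calc _ ≤ ∫ a, (Real.exp (1 * inner ℝ u a) + Real.exp (-1 * inner ℝ u a)) ∂(stdGaussian F) :=
        integral_mono hI (i1.add i2) hle
    _ ≤ Real.exp (1 / 2) + Real.exp (1 / 2) := by
        rw [integral_add i1 i2]; exact add_le_add e1 e2
    _ = 2 * Real.exp (1 / 2) := by ring
    _ ≤ Real.exp 1 * Real.exp (1 / 2) := by
        have : (2 : ℝ) ≤ Real.exp 1 := by linarith [Real.add_one_le_exp (1 : ℝ)]
        gcongr
    _ ≤ Real.exp 2 := by
        rw [← Real.exp_add]; apply Real.exp_le_exp.2; norm_num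

/-- Lower-tail Chernoff bound for the number of independent samples hitting a set. -/
lemma pi_real_card_le {Ω : Type*} [MeasurableSpace Ω] (γ : Measure Ω) [IsProbabilityMeasure γ]
    {S : Set Ω} [DecidablePred (· ∈ S)] (hS : MeasurableSet S) {q a : ℝ} (hq : 0 < q)
    (hqS : q ≤ γ.real S) (ha : 0 ≤ a) (m : ℕ) :
    (Measure.pi fun _ : Fin m => γ).real
      {A | ((Finset.univ.filter fun i => A i ∈ S).card : ℝ) ≤ (q - a) * m} ≤
        Real.exp (-(m * a ^ 2 / (2 * q))) := by
  set l := a / q with hl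
  have hl0 : 0 ≤ l := div_nonneg ha hq.le
  set f : Ω → ℝ := fun ω => Real.exp (-l * S.indicator (fun _ => (1 : ℝ)) ω) with hf
  have hfm : Measurable f := by
    have : Measurable (S.indicator (fun _ => (1 : ℝ))) := measurable_const.indicator hS
    fun_prop
  have hf_eq : f = fun ω => 1 - S.indicator (fun _ => 1 - Real.exp (-l)) ω := by
    ext ω
    by_cases h : ω ∈ S <;> simp [hf, h]
  have hfi : Integrable f γ := by
    rw [hf_eq]
    exact (integrable_const _).sub ((integrable_const _).indicator hS)
  have hf_int : ∫ ω, f ω ∂γ = 1 - γ.real S * (1 - Real.exp (-l)) := by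
    rw [hf_eq, integral_sub (integrable_const _) ((integrable_const _).indicator hS),
      integral_indicator_const _ hS]
    simp
  have hexp1 : Real.exp (-l) ≤ 1 := Real.exp_le_one_iff.2 (by linarith)
  have hexp2 : l - l ^ 2 / 2 ≤ 1 - Real.exp (-l) := by
    have h1 := Real.quadratic_le_exp_of_nonneg hl0
    have h2 : Real.exp (-l) * Real.exp l = 1 := by rw [← Real.exp_add]; simp
    have h3 : Real.exp (-l) * (1 + l + l ^ 2 / 2) ≤ 1 :=
      (mul_le_mul_of_nonneg_left h1 (Real.exp_nonneg _)).trans_eq h2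
    have h4 : (1 - l + l ^ 2 / 2) * (1 + l + l ^ 2 / 2) = 1 + l ^ 4 / 4 := by ring
    have h5 : 0 < 1 + l + l ^ 2 / 2 := by positivity
    have h6 : Real.exp (-l) ≤ 1 - l + l ^ 2 / 2 := by
      by_contra hcon
      push Not at hcon
      have := mul_lt_mul_of_pos_right hcon h5
      have : 0 ≤ l ^ 4 := by positivity
      linarith
    linarith
  have hint_le : ∫ ω, f ω ∂γ ≤ Real.exp (-(q * (l - l ^ 2 / 2))) := by
    rw [hf_int]
    have h1 : q * (l - l ^ 2 / 2) ≤ γ.real S * (1 - Real.exp (-l)) :=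
      (mul_le_mul_of_nonneg_left hexp2 hq.le).trans
        (mul_le_mul_of_nonneg_right hqS (by linarith))
    have := Real.add_one_le_exp (-(q * (l - l ^ 2 / 2)))
    linarith
  have hprod : ∀ A : Fin m → Ω, ∏ i, f (A i) =
      Real.exp (-l * ((Finset.univ.filter fun i => A i ∈ S).card : ℝ)) := by
    intro A
    rw [← Real.exp_sum, ← Finset.mul_sum]
    congr 2
    simp [Set.indicator_apply]
  have hI : Integrable (fun A : Fin m → Ω => ∏ i, f (A i)) (Measure.pi fun _ => γ) :=
    Integrable.fintype_prod (fun _ => hfi)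
  have hE : ∫ A : Fin m → Ω, ∏ i, f (A i) ∂(Measure.pi fun _ => γ) = (∫ ω, f ω ∂γ) ^ m := by
    rw [integral_fintype_prod_eq_pow, Fintype.card_fin]
  have hmarkov := mul_meas_ge_le_integral_of_nonneg (μ := Measure.pi fun _ : Fin m => γ)
    (f := fun A => ∏ i, f (A i))
    (Filter.Eventually.of_forall fun A => Finset.prod_nonneg fun i _ => Real.exp_nonneg _) hI
    (Real.exp (-l * ((q - a) * m)))
  have hset : {A : Fin m → Ω | ((Finset.univ.filter fun i => A i ∈ S).card : ℝ) ≤ (q - a) * m} ⊆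
      {A | Real.exp (-l * ((q - a) * m)) ≤ ∏ i, f (A i)} := by
    intro A hA
    simp only [Set.mem_ofPred_eq] at hA ⊢
    rw [hprod]
    apply Real.exp_le_exp.2
    rw [neg_mul, neg_mul]
    exact neg_le_neg (mul_le_mul_of_nonneg_left hA hl0)
  have h1 := measureReal_mono (μ := Measure.pi fun _ : Fin m => γ) hset
  have hnn : 0 ≤ ∫ ω, f ω ∂γ := integral_nonneg fun ω => Real.exp_nonneg _
  have h2 : Real.exp (-l * ((q - a) * m)) * (Measure.pi fun _ : Fin m => γ).real
      {A | Real.exp (-l * ((q - a) * m)) ≤ ∏ i, f (A i)} ≤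
        Real.exp (-(q * (l - l ^ 2 / 2))) ^ m := by
    refine hmarkov.trans ?_
    rw [hE]
    exact pow_le_pow_left₀ hnn hint_le m
  rw [← Real.exp_nat_mul] at h2
  have h3 : Real.exp (m * -(q * (l - l ^ 2 / 2))) =
      Real.exp (-l * ((q - a) * m)) * Real.exp (-(m * a ^ 2 / (2 * q))) := by
    rw [← Real.exp_add]
    congr 1
    rw [hl]
    field_simp
    ring
  rw [h3] at h2
  exact h1.trans (le_of_mul_le_mul_left h2 (Real.exp_pos _))

variable {F : Type*} [NormedAddCommGroup F] [InnerProductSpace ℝ F] [FiniteDimensional ℝ F]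
  [MeasurableSpace F] [BorelSpace F]

lemma pi_real_le_sum_abs_inner {h : F} {σ : ℝ} (hσ : 0 < σ) (hh : ‖h‖ ≤ σ) (m : ℕ) (T : ℝ) :
    (Measure.pi fun _ : Fin m => stdGaussian F).real {A | T ≤ ∑ i, |inner ℝ h (A i)|} ≤
      Real.exp (2 * m - T / σ) := by
  set u := σ⁻¹ • h with hu
  have hu1 : ‖u‖ ≤ 1 := by
    rw [hu, norm_smul, norm_inv, Real.norm_of_nonneg hσ.le, inv_mul_le_iff₀ hσ, mul_one]
    exact hh
  obtain ⟨hi, he⟩ := integral_exp_abs_inner_le hu1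
  set f : F → ℝ := fun a => Real.exp |inner ℝ u a| with hf
  have hI : Integrable (fun A : Fin m → F => ∏ i, f (A i)) (Measure.pi fun _ => stdGaussian F) :=
    Integrable.fintype_prod (fun _ => hi)
  have hE : ∫ A : Fin m → F, ∏ i, f (A i) ∂(Measure.pi fun _ => stdGaussian F) =
      (∫ ω, f ω ∂(stdGaussian F)) ^ m := by
    rw [integral_fintype_prod_eq_pow, Fintype.card_fin]
  have hmarkov := mul_meas_ge_le_integral_of_nonneg
    (μ := Measure.pi fun _ : Fin m => stdGaussian F) (f := fun A => ∏ i, f (A i))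
    (Filter.Eventually.of_forall fun A => Finset.prod_nonneg fun i _ => Real.exp_nonneg _) hI
    (Real.exp (T / σ))
  have hset : {A : Fin m → F | T ≤ ∑ i, |inner ℝ h (A i)|} ⊆
      {A | Real.exp (T / σ) ≤ ∏ i, f (A i)} := by
    intro A hA
    simp only [Set.mem_ofPred_eq, hf] at hA ⊢
    rw [← Real.exp_sum]
    apply Real.exp_le_exp.2
    simp only [hu, real_inner_smul_left, abs_mul, abs_inv, abs_of_pos hσ]
    rw [← Finset.mul_sum, div_eq_inv_mul]
    exact mul_le_mul_of_nonneg_left hA (inv_nonneg.2 hσ.le)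
  have h1 := measureReal_mono (μ := Measure.pi fun _ : Fin m => stdGaussian F) hset
  have hnn : 0 ≤ ∫ ω, f ω ∂(stdGaussian F) := integral_nonneg fun ω => Real.exp_nonneg _
  have h2 : Real.exp (T / σ) * (Measure.pi fun _ : Fin m => stdGaussian F).real
      {A | Real.exp (T / σ) ≤ ∏ i, f (A i)} ≤ Real.exp 2 ^ m := by
    refine hmarkov.trans ?_
    rw [hE]
    exact pow_le_pow_left₀ hnn he m
  rw [← Real.exp_nat_mul] at h2
  have h3 : Real.exp (m * 2) = Real.exp (T / σ) * Real.exp (2 * m - T / σ) := by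
    rw [← Real.exp_add]
    congr 1
    ring
  rw [h3] at h2
  exact h1.trans (le_of_mul_le_mul_left h2 (Real.exp_pos _))

section Nets

variable {E : Type*} [NormedAddCommGroup E] [NormedSpace ℝ E] [FiniteDimensional ℝ E]

open Metric Module in
/-- Volume bound on the number of separated points in a ball. -/
lemma card_le_of_separated_closedBall {R η : ℝ} (hR : 0 ≤ R) (hη : 0 < η) (s : Finset E)
    (hs : ∀ c ∈ s, ‖c‖ ≤ R) (h : ∀ c ∈ s, ∀ d ∈ s, c ≠ d → η ≤ ‖c - d‖) :
    (s.card : ℝ) ≤ (1 + 2 * R / η) ^ finrank ℝ E := by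
  borelize E
  let μ : Measure E := Measure.addHaar
  have hδ : 0 < η / 2 := by positivity
  have hρ : 0 < R + η / 2 := by positivity
  have hdisj : (s : Set E).PairwiseDisjoint fun c => ball c (η / 2) := by
    rintro c hc d hd hcd
    apply ball_disjoint_ball
    rw [dist_eq_norm]
    linarith [h c hc d hd hcd]
  have hsub : (⋃ c ∈ s, ball c (η / 2)) ⊆ ball (0 : E) (R + η / 2) := by
    refine Set.iUnion₂_subset fun x hx => ball_subset_ball' ?_
    rw [dist_zero_right]
    linarith [hs x hx]
  have hI : (s.card : ENNReal) * ENNReal.ofReal ((η / 2) ^ finrank ℝ E) * μ (ball 0 1) ≤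
      ENNReal.ofReal ((R + η / 2) ^ finrank ℝ E) * μ (ball 0 1) :=
    calc
      _ = μ (⋃ c ∈ s, ball c (η / 2)) := by
        rw [measure_biUnion_finset hdisj fun c _ => measurableSet_ball]
        simp only [μ.addHaar_ball_of_pos _ hδ, Finset.sum_const, nsmul_eq_mul, mul_assoc]
      _ ≤ μ (ball (0 : E) (R + η / 2)) := measure_mono hsub
      _ = _ := by rw [μ.addHaar_ball_of_pos _ hρ]
  have hJ := (ENNReal.mul_le_mul_iff_left (measure_ball_pos μ _ zero_lt_one).ne'
    measure_ball_lt_top.ne).1 hI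
  have hK := ENNReal.toReal_le_of_le_ofReal (pow_nonneg hρ.le _) hJ
  rw [ENNReal.toReal_mul, ENNReal.toReal_natCast, ENNReal.toReal_ofReal (by positivity),
    ← le_div_iff₀ (by positivity), ← div_pow] at hK
  convert! hK using 2
  field_simp
  ring

open Module in
/-- A ball has a finite net of controlled cardinality. -/
lemma exists_net_closedBall {R η : ℝ} (hR : 0 ≤ R) (hη : 0 < η) :
    ∃ s : Finset E, (∀ c ∈ s, ‖c‖ ≤ R) ∧ (∀ x : E, ‖x‖ ≤ R → ∃ c ∈ s, ‖x - c‖ ≤ η) ∧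
      (s.card : ℝ) ≤ (1 + 2 * R / η) ^ finrank ℝ E := by
  classical
  let P : ℕ → Prop := fun k => ∃ s : Finset E, (∀ c ∈ s, ‖c‖ ≤ R) ∧
    (∀ c ∈ s, ∀ d ∈ s, c ≠ d → η ≤ ‖c - d‖) ∧ s.card = k
  have hP0 : P 0 := ⟨∅, by simp, by simp, rfl⟩
  have hPb : ∀ k, P k → k ≤ ⌊(1 + 2 * R / η) ^ finrank ℝ E⌋₊ := by
    rintro k ⟨s, h1, h2, rfl⟩
    exact Nat.le_floor (card_le_of_separated_closedBall hR hη s h1 h2)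
  set M := Nat.findGreatest P ⌊(1 + 2 * R / η) ^ finrank ℝ E⌋₊
  obtain ⟨s, h1, h2, h3⟩ : P M := Nat.findGreatest_spec (Nat.zero_le _) hP0
  refine ⟨s, h1, fun x hx => ?_, card_le_of_separated_closedBall hR hη s h1 h2⟩
  by_contra! hcon
  have hxs : x ∉ s := fun hxs => by
    have := hcon x hxs
    simp only [sub_self, norm_zero] at this
    linarith
  have hP : P (M + 1) := by
    refine ⟨insert x s, ?_, ?_, by rw [Finset.card_insert_of_notMem hxs, h3]⟩
    · intro c hc
      rcases Finset.mem_insert.1 hc with rfl | hc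
      exacts [hx, h1 c hc]
    · intro c hc d hd hcd
      rcases Finset.mem_insert.1 hc with rfl | hc' <;> rcases Finset.mem_insert.1 hd with rfl | hd'
      · exact absurd rfl hcd
      · exact (hcon d hd').le
      · rw [norm_sub_rev]; exact (hcon c hc').le
      · exact h2 c hc' d hd' hcd
  have := Nat.le_findGreatest (hPb _ hP) hP
  omega

end Nets

section Chaining

variable {F : Type*} [NormedAddCommGroup F] [InnerProductSpace ℝ F]

/-- The `ℓ¹` norm of the measurements of `h` by the rows of `A`. -/
def sumAbsInner {m : ℕ} (A : Fin m → F) (h : F) : ℝ := ∑ i, |inner ℝ h (A i)|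

lemma sumAbsInner_add_le {m : ℕ} (A : Fin m → F) (h k : F) :
    sumAbsInner A (h + k) ≤ sumAbsInner A h + sumAbsInner A k := by
  unfold sumAbsInner
  rw [← Finset.sum_add_distrib]
  refine Finset.sum_le_sum fun i _ => ?_
  rw [inner_add_left]
  exact abs_add_le _ _

lemma continuous_sumAbsInner {m : ℕ} (A : Fin m → F) : Continuous (sumAbsInner A) := by
  unfold sumAbsInner
  fun_prop

variable {E : Type*} [NormedAddCommGroup E] [NormedSpace ℝ E]

omit [NormedSpace ℝ E] in
/-- Deterministic chaining: increments along nets at dyadic scales control all increments. -/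
lemma sumAbsInner_le_of_chain {Φ : E → F} (hΦ : LipschitzWith 1 Φ) {ρ l : ℝ}
    (hl : 0 ≤ l) {N : ℕ → Set E} (hN0 : N 0 = {0})
    (hN : ∀ k, ∀ t : E, ‖t‖ ≤ ρ → ∃ p ∈ N k, ‖t - p‖ ≤ ρ / 2 ^ k) {m : ℕ} {A : Fin m → F}
    (hA : ∀ k, ∀ p ∈ N k, ∀ q ∈ N (k + 1), ‖q - p‖ ≤ 2 * ρ / 2 ^ k →
      sumAbsInner A (Φ q - Φ p) ≤ l / 4 * (3 / 4) ^ k * m) {t : E} (ht : ‖t‖ ≤ ρ) :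
    sumAbsInner A (Φ t - Φ 0) ≤ l * m := by
  have hρ : 0 ≤ ρ := (norm_nonneg t).trans ht
  choose p hpN hp using fun k => hN k t ht
  have hp0 : p 0 = 0 := by simpa [hN0] using hpN 0
  have hstep : ∀ k, sumAbsInner A (Φ (p (k + 1)) - Φ (p k)) ≤ l / 4 * (3 / 4) ^ k * m := by
    refine fun k => hA k _ (hpN k) _ (hpN (k + 1)) ?_
    have h1 : p (k + 1) - p k = (t - p k) - (t - p (k + 1)) := by abel
    rw [h1]
    refine (norm_sub_le _ _).trans ((add_le_add (hp k) (hp (k + 1))).trans ?_)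
    have h2 : ρ / 2 ^ (k + 1) ≤ ρ / 2 ^ k :=
      div_le_div_of_nonneg_left hρ (by positivity)
        (pow_le_pow_right₀ (by norm_num) (Nat.le_succ k))
    rw [mul_div_assoc]
    linarith
  have hpart : ∀ K, sumAbsInner A (Φ (p K) - Φ 0) ≤ l * m * (1 - (3 / 4) ^ K) := by
    intro K
    induction K with
    | zero => simp [hp0, sumAbsInner]
    | succ K ih =>
      have h1 : Φ (p (K + 1)) - Φ 0 = (Φ (p (K + 1)) - Φ (p K)) + (Φ (p K) - Φ 0) := by abel
      rw [h1]
      refine (sumAbsInner_add_le _ _ _).trans ((add_le_add (hstep K) ih).trans_eq ?_)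
      ring
  have hlim : Filter.Tendsto p Filter.atTop (nhds t) := by
    rw [tendsto_iff_norm_sub_tendsto_zero]
    refine squeeze_zero (fun _ => norm_nonneg _)
      (fun k => (norm_sub_rev (p k) t).trans_le (hp k)) ?_
    have := (tendsto_pow_atTop_nhds_zero_of_lt_one (r := (1 / 2 : ℝ)) (by norm_num)
      (by norm_num)).const_mul ρ
    simpa [div_eq_mul_inv] using this
  have hlim' : Filter.Tendsto (fun K => sumAbsInner A (Φ (p K) - Φ 0)) Filter.atTop
      (nhds (sumAbsInner A (Φ t - Φ 0))) :=
    ((continuous_sumAbsInner A).tendsto _).comp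
      (((hΦ.continuous.tendsto t).comp hlim).sub_const _)
  refine le_of_tendsto' hlim' fun K => (hpart K).trans ?_
  have h1 : (0 : ℝ) ≤ (3 / 4) ^ K := by positivity
  have h2 : 0 ≤ l * m := by positivity
  nlinarith

variable [FiniteDimensional ℝ E] [FiniteDimensional ℝ F] [MeasurableSpace F] [BorelSpace F]

open Module in
/-- Chaining bound for the measurements of increments of a `1`-Lipschitz map on a small ball. -/
lemma pi_exists_sumAbsInner_le {Φ : E → F} (hΦ : LipschitzWith 1 Φ) {ρ l : ℝ} (hρ : 0 < ρ)
    (hl : 0 < l) {m : ℕ} (hm : 1 ≤ m) (hQ : 8 ≤ l / (8 * ρ))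
    (hs : (finrank ℝ E : ℝ) ≤ m * (l / (8 * ρ)) / 16) :
    (Measure.pi fun _ : Fin m => stdGaussian F)
      {A | ∃ t, ‖t‖ ≤ ρ ∧ l * m < sumAbsInner A (Φ t - Φ 0)} ≤
        ENNReal.ofReal (Real.exp (-(m * (l / (8 * ρ)) / 4))) := by
  set Q := l / (8 * ρ) with hQdef
  set s := finrank ℝ E
  set μ := Measure.pi fun _ : Fin m => stdGaussian F
  have hm' : (1 : ℝ) ≤ m := by exact_mod_cast hm
  have hnet : ∀ k : ℕ, ∃ N : Finset E, (k = 0 → N = {0}) ∧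
      (∀ t : E, ‖t‖ ≤ ρ → ∃ p ∈ N, ‖t - p‖ ≤ ρ / 2 ^ k) ∧
      (N.card : ℝ) ≤ (3 * 2 ^ k) ^ s := by
    intro k
    rcases Nat.eq_zero_or_pos k with rfl | hk
    · refine ⟨{0}, fun _ => rfl, fun t ht => ⟨0, by simp, by simpa using ht⟩, ?_⟩
      simpa using one_le_pow₀ (by norm_num : (1 : ℝ) ≤ 3)
    · obtain ⟨N, -, h2, h3⟩ := exists_net_closedBall (E := E) hρ.le
        (by positivity : 0 < ρ / 2 ^ k)
      refine ⟨N, fun h => by omega, h2, h3.trans (pow_le_pow_left₀ (by positivity) ?_ _)⟩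
      have h4 : (1 : ℝ) ≤ 2 ^ k := one_le_pow₀ (by norm_num)
      have h5 : 2 * ρ / (ρ / 2 ^ k) = 2 * 2 ^ k := by field_simp
      rw [h5]
      linarith
  choose N hN0 hN hNc using hnet
  let B : ℕ → Set (Fin m → F) := fun k => ⋃ pq ∈ (N k ×ˢ N (k + 1)).filter
    (fun pq => ‖pq.2 - pq.1‖ ≤ 2 * ρ / 2 ^ k),
      {A | l / 4 * (3 / 4) ^ k * m ≤ sumAbsInner A (Φ pq.2 - Φ pq.1)}
  have hsub : {A | ∃ t, ‖t‖ ≤ ρ ∧ l * m < sumAbsInner A (Φ t - Φ 0)} ⊆ ⋃ k, B k := by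
    rintro A ⟨t, ht, hA⟩
    by_contra hcon
    refine hA.not_ge (sumAbsInner_le_of_chain hΦ hl.le (N := fun k => (N k : Set E))
      (by simp [hN0 0 rfl]) hN ?_ ht)
    intro k p hp q hq hpq
    by_contra hlt
    push Not at hlt
    refine hcon (Set.mem_iUnion.2 ⟨k, Set.mem_iUnion₂.2 ⟨(p, q), ?_, hlt.le⟩⟩)
    exact Finset.mem_filter.2 ⟨Finset.mem_product.2 ⟨hp, hq⟩, hpq⟩
  have hpair : ∀ k : ℕ, ∀ pq ∈ (N k ×ˢ N (k + 1)).filter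
      (fun pq => ‖pq.2 - pq.1‖ ≤ 2 * ρ / 2 ^ k),
      μ.real {A | l / 4 * (3 / 4) ^ k * m ≤ sumAbsInner A (Φ pq.2 - Φ pq.1)} ≤
        Real.exp (2 * m - m * Q * (3 / 2) ^ k) := by
    intro k pq hpq
    have h1 := (Finset.mem_filter.1 hpq).2
    have h2 : ‖Φ pq.2 - Φ pq.1‖ ≤ 2 * ρ / 2 ^ k := by
      have := hΦ.dist_le_mul pq.2 pq.1
      rw [dist_eq_norm, dist_eq_norm] at this
      simpa using this.trans (by simpa using h1)
    refine (pi_real_le_sum_abs_inner (by positivity) h2 m _).trans_eq ?_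
    congr 2
    have h3 : (3 / 2 : ℝ) ^ k = (3 / 4) ^ k * 2 ^ k := by rw [← mul_pow]; norm_num
    rw [h3, hQdef]
    field_simp
    ring
  have hBk : ∀ k, μ (B k) ≤ ENNReal.ofReal (Real.exp (-(m * Q / 4)) / 2 / 2 ^ k) := by
    intro k
    refine (ENNReal.le_ofReal_iff_toReal_le (measure_ne_top _ _) (by positivity)).2 ?_
    change μ.real (B k) ≤ _
    refine (measureReal_biUnion_finset_le _ _).trans ((Finset.sum_le_sum (hpair k)).trans ?_)
    rw [Finset.sum_const, nsmul_eq_mul]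
    have hcard : (((N k ×ˢ N (k + 1)).filter
        (fun pq => ‖pq.2 - pq.1‖ ≤ 2 * ρ / 2 ^ k)).card : ℝ) ≤ Real.exp (s * (3 + 2 * k)) := by
      have h1 : ((N k ×ˢ N (k + 1)).card : ℝ) ≤ (3 * 2 ^ k) ^ s * (3 * 2 ^ (k + 1)) ^ s := by
        rw [Finset.card_product, Nat.cast_mul]
        exact mul_le_mul (hNc k) (hNc (k + 1)) (by positivity) (by positivity)
      have h2 : (((N k ×ˢ N (k + 1)).filter
        (fun pq => ‖pq.2 - pq.1‖ ≤ 2 * ρ / 2 ^ k)).card : ℝ) ≤ (N k ×ˢ N (k + 1)).card := by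
        exact_mod_cast Finset.card_filter_le _ _
      refine h2.trans (h1.trans ?_)
      rw [← mul_pow, Real.exp_nat_mul]
      refine pow_le_pow_left₀ (by positivity) ?_ _
      have h3 : Real.exp (3 + 2 * (k : ℝ)) = Real.exp 1 ^ 3 * (Real.exp 1 ^ 2) ^ k := by
        rw [← pow_mul, ← Real.exp_nat_mul, ← Real.exp_nat_mul, ← Real.exp_add]
        push_cast
        congr 1
        ring
      have he := Real.exp_one_gt_d9
      have h4 : (18 : ℝ) ≤ Real.exp 1 ^ 3 :=
        le_trans (by norm_num) (pow_le_pow_left₀ (by norm_num : (0 : ℝ) ≤ 2.7182818283) he.le 3)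
      have h5 : (4 : ℝ) ≤ Real.exp 1 ^ 2 :=
        le_trans (by norm_num) (pow_le_pow_left₀ (by norm_num : (0 : ℝ) ≤ 2.7182818283) he.le 2)
      have h6 : (3 * 2 ^ k * (3 * 2 ^ (k + 1)) : ℝ) = 18 * 4 ^ k := by
        have : (4 : ℝ) ^ k = 2 ^ k * 2 ^ k := by rw [← mul_pow]; norm_num
        rw [this, pow_succ]
        ring
      rw [h3, h6]
      exact mul_le_mul h4 (pow_le_pow_left₀ (by norm_num) h5 k) (by positivity) (by positivity)
    refine (mul_le_mul_of_nonneg_right hcard (Real.exp_nonneg _)).trans ?_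
    rw [← Real.exp_add]
    have hmQ : 8 ≤ m * Q := by nlinarith
    have hbern : 1 + (k : ℝ) / 2 ≤ (3 / 2 : ℝ) ^ k := by
      have := one_add_mul_le_pow (a := (1 / 2 : ℝ)) (by norm_num) k
      convert! this using 1
      · ring
      · norm_num
    have hexp : (s : ℝ) * (3 + 2 * k) + (2 * m - m * Q * (3 / 2) ^ k) ≤
        -(m * Q / 4) + ((k + 1 : ℕ) : ℝ) * (-2) := by
      have hk : (0 : ℝ) ≤ k := Nat.cast_nonneg k
      have h1 : (s : ℝ) * (3 + 2 * k) ≤ m * Q / 16 * (3 + 2 * k) :=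
        mul_le_mul_of_nonneg_right hs (by positivity)
      have h2 : m * Q * (1 + (k : ℝ) / 2) ≤ m * Q * (3 / 2) ^ k :=
        mul_le_mul_of_nonneg_left hbern (by linarith)
      have h3 : 2 * (m : ℝ) ≤ m * Q / 4 := by nlinarith
      have h4 : 8 * (k : ℝ) ≤ m * Q * k := mul_le_mul_of_nonneg_right hmQ hk
      push_cast
      linarith
    refine (Real.exp_le_exp.2 hexp).trans ?_
    rw [Real.exp_add, Real.exp_nat_mul]
    have h2 : Real.exp (-2) ≤ 1 / 2 := by
      rw [Real.exp_neg, ← one_div]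
      refine one_div_le_one_div_of_le (by norm_num) ?_
      linarith [Real.add_one_le_exp (2 : ℝ)]
    have h3 := pow_le_pow_left₀ (Real.exp_nonneg (-2)) h2 (k + 1)
    refine (mul_le_mul_of_nonneg_left h3 (Real.exp_nonneg _)).trans_eq ?_
    rw [pow_succ]
    field_simp
    rw [← mul_pow]
    norm_num
  refine (measure_mono hsub).trans ((measure_iUnion_le B).trans ((ENNReal.tsum_le_tsum hBk).trans ?_))
  rw [← ENNReal.ofReal_tsum_of_nonneg (fun k => by positivity) (summable_geometric_two' _),
    tsum_geometric_two']

end Chaining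

section Signs

variable {F : Type*} [NormedAddCommGroup F] [InnerProductSpace ℝ F]

/-- The angle between two vectors of norm at least `R` is controlled by their distance. -/
lemma angle_div_pi_le_norm_sub {x y : F} {R : ℝ} (hR : 0 < R) (hx : R ≤ ‖x‖) (hy : R ≤ ‖y‖) :
    InnerProductGeometry.angle x y / Real.pi ≤ ‖x - y‖ / (2 * R) := by
  set θ := InnerProductGeometry.angle x y with hθ
  have h0 : 0 ≤ θ := InnerProductGeometry.angle_nonneg x y
  have h1 : θ ≤ Real.pi := InnerProductGeometry.angle_le_pi x y
  have hpi := Real.pi_pos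
  have hcos := InnerProductGeometry.cos_angle_mul_norm_mul_norm x y
  have hsin : θ / Real.pi ≤ Real.sin (θ / 2) := by
    have := Real.mul_le_sin (x := θ / 2) (by linarith) (by linarith)
    refine le_trans (le_of_eq ?_) this
    field_simp
  have hsq : Real.sin (θ / 2) ^ 2 = 1 / 2 - Real.cos θ / 2 := by
    rw [Real.sin_sq_eq_half_sub]
    congr 3
    ring
  have hn : ‖x - y‖ ^ 2 = ‖x‖ ^ 2 - 2 * inner ℝ x y + ‖y‖ ^ 2 := norm_sub_sq_real x y
  have hxy : R * R ≤ ‖x‖ * ‖y‖ := mul_le_mul hx hy hR.le (norm_nonneg _)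
  have hs0 : 0 ≤ Real.sin (θ / 2) ^ 2 := sq_nonneg _
  have hmain : (2 * R * (θ / Real.pi)) ^ 2 ≤ ‖x - y‖ ^ 2 := by
    have h2 : (θ / Real.pi) ^ 2 ≤ Real.sin (θ / 2) ^ 2 :=
      pow_le_pow_left₀ (by positivity) hsin 2
    have h3 : ‖x - y‖ ^ 2 = (‖x‖ - ‖y‖) ^ 2 + 4 * (‖x‖ * ‖y‖) * Real.sin (θ / 2) ^ 2 := by
      rw [hn, ← hcos, hsq]
      ring
    have h4 : R * R * Real.sin (θ / 2) ^ 2 ≤ ‖x‖ * ‖y‖ * Real.sin (θ / 2) ^ 2 :=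
      mul_le_mul_of_nonneg_right hxy hs0
    have h5 : R * R * (θ / Real.pi) ^ 2 ≤ R * R * Real.sin (θ / 2) ^ 2 :=
      mul_le_mul_of_nonneg_left h2 (by positivity)
    nlinarith [sq_nonneg (‖x‖ - ‖y‖)]
  have := abs_le_of_sq_le_sq' hmain (norm_nonneg _)
  rw [le_div_iff₀ (by positivity)]
  linarith [this.2]

/-- The number of one-bit measurements distinguishing `y` and `y'`. -/
def signDiff {m : ℕ} (A : Fin m → F) (y y' : F) : ℕ :=
  (Finset.univ.filter fun i => sgn (inner ℝ y (A i)) ≠ sgn (inner ℝ y' (A i))).card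

lemma signDiff_comm {m : ℕ} (A : Fin m → F) (y y' : F) : signDiff A y y' = signDiff A y' y := by
  simp only [signDiff, ne_comm]

lemma card_le_of_sumAbsInner_le {m : ℕ} {A : Fin m → F} {h : F} {κ b : ℝ} (hκ : 0 < κ)
    (hh : sumAbsInner A h ≤ b * κ * m) :
    ((Finset.univ.filter fun i => κ ≤ |inner ℝ h (A i)|).card : ℝ) ≤ b * m := by
  have h1 : ((Finset.univ.filter fun i => κ ≤ |inner ℝ h (A i)|).card : ℝ) * κ ≤
      sumAbsInner A h := by
    rw [← nsmul_eq_mul, ← Finset.sum_const]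
    refine (Finset.sum_le_sum fun i hi => (Finset.mem_filter.1 hi).2).trans ?_
    exact Finset.sum_le_sum_of_subset_of_nonneg (Finset.filter_subset _ _)
      fun i _ _ => abs_nonneg _
  have h2 := h1.trans hh
  rw [mul_right_comm] at h2
  exact le_of_mul_le_mul_right h2 hκ

open Classical in
/-- Well-separated measurements of `x, x'` distinguish all small perturbations `y, y'`. -/
lemma card_marginSet_le_signDiff {m : ℕ} {A : Fin m → F} {x x' y y' : F} {κ b : ℝ} (hκ : 0 < κ)
    (hy : sumAbsInner A (y - x) ≤ b * κ * m) (hy' : sumAbsInner A (y' - x') ≤ b * κ * m) :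
    ((Finset.univ.filter fun i => A i ∈ marginSet x x' κ).card : ℝ) ≤
      signDiff A y y' + 2 * b * m := by
  have hsub : (Finset.univ.filter fun i => A i ∈ marginSet x x' κ) ⊆
      (Finset.univ.filter fun i => sgn (inner ℝ y (A i)) ≠ sgn (inner ℝ y' (A i))) ∪
      ((Finset.univ.filter fun i => κ ≤ |inner ℝ (y - x) (A i)|) ∪
        (Finset.univ.filter fun i => κ ≤ |inner ℝ (y' - x') (A i)|)) := by
    intro i hi
    simp only [Finset.mem_union, Finset.mem_filter, Finset.mem_univ, true_and] at hi ⊢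
    by_contra! hcon
    obtain ⟨h1, h2, h3⟩ := hcon
    rw [inner_sub_left, abs_lt] at h2 h3
    unfold sgn at h1
    rcases hi with ⟨h4, h5⟩ | ⟨h4, h5⟩
    · rw [if_pos (by linarith), if_neg (by linarith)] at h1
      norm_num at h1
    · rw [if_neg (by linarith), if_pos (by linarith)] at h1
      norm_num at h1
  have h1 := (Finset.card_le_card hsub).trans ((Finset.card_union_le _ _).trans
    (Nat.add_le_add_left (Finset.card_union_le _ _) _))
  have h2 : ((Finset.univ.filter fun i => A i ∈ marginSet x x' κ).card : ℝ) ≤ _ :=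
    Nat.cast_le.2 h1
  push_cast at h2
  have h3 := card_le_of_sumAbsInner_le hκ hy
  have h4 := card_le_of_sumAbsInner_le hκ hy'
  unfold signDiff
  linarith

open Classical in
/-- If few measurements distinguish `y` and `y'`, and the measurements behave well at the nearby
points `x` and `x'`, then the angle between `y` and `y'` is small. -/
lemma angle_div_pi_le_signDiff {m : ℕ} (hm : 1 ≤ m) {A : Fin m → F} {x x' y y' : F}
    {κ a b ρ : ℝ} (hκ : 0 < κ)
    (hy : sumAbsInner A (y - x) ≤ b * κ * m) (hy' : sumAbsInner A (y' - x') ≤ b * κ * m)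
    (hx1 : 1 / 2 ≤ ‖x‖) (hx1' : 1 / 2 ≤ ‖x'‖) (hy1 : 1 / 2 ≤ ‖y‖) (hy1' : 1 / 2 ≤ ‖y'‖)
    (hxy : ‖y - x‖ ≤ ρ) (hxy' : ‖y' - x'‖ ≤ ρ)
    (hA : (InnerProductGeometry.angle x x' / Real.pi - 4 * κ - a) * m ≤
      ((Finset.univ.filter fun i => A i ∈ marginSet x x' κ).card : ℝ)) :
    InnerProductGeometry.angle y y' / Real.pi ≤
      signDiff A y y' / m + (2 * ρ + 4 * κ + a + 2 * b) := by
  have hm' : (0 : ℝ) < m := by exact_mod_cast hm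
  have h1 := hA.trans (card_marginSet_le_signDiff hκ hy hy')
  have h2 := angle_div_pi_le_norm_sub (by norm_num) hy1 hx1
  have h3 := angle_div_pi_le_norm_sub (by norm_num) hx1' hy1'
  rw [norm_sub_rev] at h3
  have h4 : InnerProductGeometry.angle y y' ≤ InnerProductGeometry.angle y x +
      (InnerProductGeometry.angle x x' + InnerProductGeometry.angle x' y') :=
    (InnerProductGeometry.angle_le_angle_add_angle y x y').trans
      (add_le_add_right (InnerProductGeometry.angle_le_angle_add_angle x x' y') _)
  have h5 := div_le_div_of_nonneg_right h4 Real.pi_pos.le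
  rw [add_div, add_div] at h5
  have h6 : InnerProductGeometry.angle x x' / Real.pi - 4 * κ - a ≤
      signDiff A y y' / m + 2 * b := by
    rw [← mul_le_mul_iff_left₀ hm', add_mul, div_mul_cancel₀ _ hm'.ne']
    exact h1
  norm_num at h2 h3
  linarith

variable [FiniteDimensional ℝ F] [MeasurableSpace F] [BorelSpace F]

open Classical in
/-- With high probability, at least the expected fraction of measurements separates two points. -/
lemma pi_real_card_marginSet_lt {x x' : F} (hx : 1 / 2 ≤ ‖x‖) (hx' : 1 / 2 ≤ ‖x'‖)
    {κ a Θ : ℝ} (hκ : 0 ≤ κ) (ha : 0 ≤ a)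
    (hΘ' : InnerProductGeometry.angle x x' / Real.pi ≤ Θ) (m : ℕ) :
    (Measure.pi fun _ : Fin m => stdGaussian F).real
      {A | ((Finset.univ.filter fun i => A i ∈ marginSet x x' κ).card : ℝ) <
        (InnerProductGeometry.angle x x' / Real.pi - 4 * κ - a) * m} ≤
      Real.exp (-(m * a ^ 2 / (2 * Θ))) := by
  set q := InnerProductGeometry.angle x x' / Real.pi - 4 * κ with hq
  rcases le_or_gt q 0 with h | h
  · have : {A : Fin m → F | ((Finset.univ.filter fun i => A i ∈ marginSet x x' κ).card : ℝ) <
        (q - a) * m} = ∅ := by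
      ext A
      simp only [Set.mem_ofPred_eq, Set.mem_empty_iff_false, iff_false, not_lt]
      exact (mul_nonpos_of_nonpos_of_nonneg (by linarith) (Nat.cast_nonneg m)).trans
        (Nat.cast_nonneg _)
    rw [this]
    simpa using Real.exp_nonneg _
  · refine (measureReal_mono (fun A hA => ?_)).trans ((pi_real_card_le (stdGaussian F)
      (measurableSet_marginSet x x' κ) h (angle_sub_le_real_marginSet hx hx' hκ) ha m).trans ?_)
    · simp only [Set.mem_ofPred_eq] at hA ⊢
      exact hA.le
    · refine Real.exp_le_exp.2 (neg_le_neg ?_)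
      exact div_le_div_of_nonneg_left (by positivity) (by positivity) (by linarith)

end Signs

section Atlas

variable {E F : Type*} [NormedAddCommGroup E] [NormedSpace ℝ E] [FiniteDimensional ℝ E]
  [NormedAddCommGroup F] [InnerProductSpace ℝ F] [FiniteDimensional ℝ F] [MeasurableSpace F]
  [BorelSpace F]

open Module in
/-- Failure probability of the angle estimate over the pairs `P` of charts of a finite atlas. -/
lemma pi_exists_charts_lt_angle {ι : Type*} {J : Finset ι} {P : Finset (ι × ι)} {Φ : ι → E → F}
    (hΦ : ∀ j ∈ J, LipschitzWith 1 (Φ j)) (hP : ∀ p ∈ P, p.1 ∈ J ∧ p.2 ∈ J)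
    (hΦ0 : ∀ j ∈ J, 1 / 2 ≤ ‖Φ j 0‖) {κ a b ρ Θ : ℝ} (hκ : 0 < κ) (ha : 0 ≤ a) (hb : 0 < b)
    (hρ : 0 < ρ)
    (hΘ : ∀ p ∈ P, InnerProductGeometry.angle (Φ p.1 0) (Φ p.2 0) / Real.pi ≤ Θ)
    {m : ℕ} (hm : 1 ≤ m) (hQ : 8 ≤ b * κ / (8 * ρ))
    (hs : (finrank ℝ E : ℝ) ≤ m * (b * κ / (8 * ρ)) / 16) :
    (Measure.pi fun _ : Fin m => stdGaussian F)
      {A | ∃ p ∈ P, ∃ t t' : E, ‖t‖ ≤ ρ ∧ ‖t'‖ ≤ ρ ∧ 1 / 2 ≤ ‖Φ p.1 t‖ ∧ 1 / 2 ≤ ‖Φ p.2 t'‖ ∧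
        signDiff A (Φ p.1 t) (Φ p.2 t') / m + (2 * ρ + 4 * κ + a + 2 * b) <
          InnerProductGeometry.angle (Φ p.1 t) (Φ p.2 t') / Real.pi} ≤
      ENNReal.ofReal (J.card * Real.exp (-(m * (b * κ / (8 * ρ)) / 4)) +
        P.card * Real.exp (-(m * a ^ 2 / (2 * Θ)))) := by
  classical
  set μ := Measure.pi fun _ : Fin m => stdGaussian F
  let B : ι → Set (Fin m → F) := fun j =>
    {A | ∃ t, ‖t‖ ≤ ρ ∧ b * κ * m < sumAbsInner A (Φ j t - Φ j 0)}
  let D : ι × ι → Set (Fin m → F) := fun p =>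
    {A | ((Finset.univ.filter fun i => A i ∈ marginSet (Φ p.1 0) (Φ p.2 0) κ).card : ℝ) <
        (InnerProductGeometry.angle (Φ p.1 0) (Φ p.2 0) / Real.pi - 4 * κ - a) * m}
  have hsub : {A | ∃ p ∈ P, ∃ t t' : E, ‖t‖ ≤ ρ ∧ ‖t'‖ ≤ ρ ∧ 1 / 2 ≤ ‖Φ p.1 t‖ ∧
      1 / 2 ≤ ‖Φ p.2 t'‖ ∧
        signDiff A (Φ p.1 t) (Φ p.2 t') / m + (2 * ρ + 4 * κ + a + 2 * b) <
          InnerProductGeometry.angle (Φ p.1 t) (Φ p.2 t') / Real.pi} ⊆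
      (⋃ j ∈ J, B j) ∪ ⋃ p ∈ P, D p := by
    rintro A ⟨p, hp, t, t', ht, ht', h1, h2, h3⟩
    by_contra hcon
    simp only [Set.mem_union, Set.mem_iUnion, not_or, not_exists] at hcon
    have hlip : ∀ j ∈ J, ∀ t : E, ‖t‖ ≤ ρ → ‖Φ j t - Φ j 0‖ ≤ ρ := by
      intro j hj t ht
      have := (hΦ j hj).dist_le_mul t 0
      rw [dist_eq_norm, dist_eq_norm] at this
      simpa using this.trans (by simpa using ht)
    have hB : ∀ j ∈ J, ∀ t : E, ‖t‖ ≤ ρ → sumAbsInner A (Φ j t - Φ j 0) ≤ b * κ * m :=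
      fun j hj t ht => not_lt.1 fun hlt => hcon.1 j hj ⟨t, ht, hlt⟩
    have hD := hcon.2 p hp
    simp only [D, Set.mem_ofPred_eq, not_lt] at hD
    obtain ⟨hp1, hp2⟩ := hP p hp
    exact h3.not_ge (angle_div_pi_le_signDiff hm hκ (hB _ hp1 t ht) (hB _ hp2 t' ht')
      (hΦ0 _ hp1) (hΦ0 _ hp2) h1 h2 (hlip _ hp1 t ht) (hlip _ hp2 t' ht') hD)
  have hB : ∀ j ∈ J, μ (B j) ≤ ENNReal.ofReal (Real.exp (-(m * (b * κ / (8 * ρ)) / 4))) :=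
    fun j hj => pi_exists_sumAbsInner_le (hΦ j hj) hρ (by positivity) hm hQ hs
  have hD : ∀ p ∈ P, μ (D p) ≤ ENNReal.ofReal (Real.exp (-(m * a ^ 2 / (2 * Θ)))) := by
    intro p hp
    refine (ENNReal.le_ofReal_iff_toReal_le (measure_ne_top _ _) (by positivity)).2 ?_
    exact pi_real_card_marginSet_lt (hΦ0 _ (hP p hp).1) (hΦ0 _ (hP p hp).2) hκ.le ha (hΘ p hp) m
  refine (measure_mono hsub).trans ((measure_union_le _ _).trans ?_)
  rw [ENNReal.ofReal_add (by positivity) (by positivity)]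
  refine add_le_add ?_ ?_
  · refine (measure_biUnion_finset_le _ _).trans ((Finset.sum_le_sum hB).trans_eq ?_)
    rw [Finset.sum_const, ← ENNReal.ofReal_nsmul, nsmul_eq_mul]
  · refine (measure_biUnion_finset_le _ _).trans ((Finset.sum_le_sum hD).trans_eq ?_)
    rw [Finset.sum_const, ← ENNReal.ofReal_nsmul, nsmul_eq_mul]

/-- The measurement matrices for which the recovery guarantee fails, with signals of norm more than
one in the image under `g` of the ball of radius `r`. -/
def failureSet (g : E → F) (r ε : ℝ) (m : ℕ) : Set (Fin m → F) :=
  {A | ∃ u v : E, ‖u‖ ≤ r ∧ ‖v‖ ≤ r ∧ 1 < ‖g u‖ ∧ 1 < ‖g v‖ ∧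
    signDiff A (g u) (g v) / m + ε < InnerProductGeometry.angle (g u) (g v) / Real.pi}

lemma log_card_net_bound {t ε Θ l : ℝ} (hε : 0 < ε) (hε1 : ε < 1) (ht : 1 ≤ t)
    (hΘ : 0 < Θ) (hΘ1 : Θ ≤ 1) (hΘt : Θ ≤ 2 * t * ε) (hl : 0 < l) (hlt : l ≤ Real.log t) :
    Real.log 2 + 2 * Real.log (1 + 2 ^ 18 * t / ε) ≤ (31 / l + 4) * Real.log t / Θ := by
  have ht0 : 0 < t := by linarith
  have hlog2 := Real.log_two_lt_d9
  have h2pos : 0 < Real.log 2 := Real.log_pos (by norm_num)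
  have hte : 1 ≤ t / ε := by rw [le_div_iff₀ hε]; linarith
  have h1 : Real.log (1 + 2 ^ 18 * t / ε) ≤ 19 * Real.log 2 + Real.log t + Real.log (1 / ε) := by
    have : 19 * Real.log 2 + Real.log t + Real.log (1 / ε) = Real.log (2 ^ 19 * t * (1 / ε)) := by
      rw [Real.log_mul (by positivity) (by positivity), Real.log_mul (by positivity) ht0.ne',
        Real.log_pow]
      norm_num
    rw [this]
    refine Real.log_le_log (by positivity) ?_
    have h3 : 2 ^ 18 * t / ε = 2 ^ 18 * (t / ε) := by ring
    have h4 : 2 ^ 19 * t * (1 / ε) = 2 ^ 19 * (t / ε) := by ring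
    rw [h3, h4]
    linarith
  have h2 : Real.log (1 / ε) ≤ Real.log 2 + Real.log t + 1 / Θ := by
    have h3 : Real.log (1 / ε) ≤ Real.log (2 * t * (1 / Θ)) := by
      refine Real.log_le_log (by positivity) ?_
      rw [mul_one_div, div_le_div_iff₀ hε hΘ]
      linarith
    rw [Real.log_mul (by positivity) (by positivity), Real.log_mul (by norm_num) ht0.ne'] at h3
    have h4 := Real.log_le_sub_one_of_pos (show 0 < 1 / Θ by positivity)
    linarith
  have hlogt : 0 < Real.log t := hl.trans_le hlt
  have h5 : 31 ≤ 31 / l * Real.log t := by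
    rw [div_mul_eq_mul_div, le_div_iff₀ hl]
    linarith
  rw [le_div_iff₀ hΘ]
  have h6 : Real.log 2 + 2 * Real.log (1 + 2 ^ 18 * t / ε) ≤
      29 + 4 * Real.log t + 2 / Θ := by
    have : 2 / Θ = 2 * (1 / Θ) := by ring
    rw [this]
    linarith
  calc _ ≤ (29 + 4 * Real.log t + 2 / Θ) * Θ := mul_le_mul_of_nonneg_right h6 hΘ.le
    _ = (29 + 4 * Real.log t) * Θ + 2 := by field_simp
    _ ≤ (29 + 4 * Real.log t) * 1 + 2 := by gcongr
    _ ≤ _ := by linarith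

open Module in
/-- The net argument, when the effective Lipschitz constant is bounded away from one. -/
lemma pi_failureSet_le_of_log_ge {g : E → F} {L : NNReal} (hg : LipschitzWith L g)
    (hL : 0 < L) {r ε l : ℝ} (hr : 0 < r) (hε : 0 < ε) (hε1 : ε < 1) (hl : 0 < l)
    (hlt : l ≤ Real.log (L * r / ε)) {m : ℕ} (hs : 1 ≤ finrank ℝ E) {C : ℝ}
    (hC : 256 * (31 / l + 4) ≤ C)
    (hm : C * finrank ℝ E * (ε ^ 2)⁻¹ * Real.log (L * r / ε) ≤ m) :
    (Measure.pi fun _ : Fin m => stdGaussian F) (failureSet g r ε m) ≤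
      ENNReal.ofReal (Real.exp (-(m * ε ^ 2 / 256))) := by
  classical
  set t := L * r / ε with htdef
  set s := finrank ℝ E
  have hL' : (0 : ℝ) < L := hL
  have ht0 : 0 < t := by positivity
  have hlogt : 0 < Real.log t := hl.trans_le hlt
  have ht1 : 1 < t := (Real.log_pos_iff ht0.le).1 hlogt
  have hs' : (1 : ℝ) ≤ s := by exact_mod_cast hs
  have hCpos : 0 < C := lt_of_lt_of_le (by positivity) hC
  have hε2 : 1 ≤ (ε ^ 2)⁻¹ := (one_le_inv₀ (by positivity)).2 (pow_le_one₀ hε.le hε1.le)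
  have hClog : 1 ≤ C * Real.log t := by
    have h1 : 31 ≤ 31 / l * Real.log t := by
      rw [div_mul_eq_mul_div, le_div_iff₀ hl]
      linarith
    have h2 := mul_le_mul_of_nonneg_right hC hlogt.le
    linarith
  have hsm : (s : ℝ) ≤ m := by
    refine le_trans ?_ hm
    have h1 : C * s * (ε ^ 2)⁻¹ * Real.log t = (C * Real.log t) * (s * (ε ^ 2)⁻¹) := by ring
    rw [h1]
    have h2 : (s : ℝ) ≤ s * (ε ^ 2)⁻¹ := le_mul_of_one_le_right (by positivity) hε2
    exact h2.trans (le_mul_of_one_le_left (by positivity) hClog)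
  have hm1 : 1 ≤ m := by exact_mod_cast hs'.trans hsm
  set ρ := ε ^ 2 / 2 ^ 17 with hρdef
  have hρ : 0 < ρ := by positivity
  have hρ1 : ρ ≤ 1 / 2 := by
    have : ε ^ 2 ≤ 1 := pow_le_one₀ hε.le hε1.le
    rw [hρdef]
    linarith
  obtain ⟨N, hN1, hN2, hN3⟩ := exists_net_closedBall (E := E) hr.le (div_pos hρ hL')
  set J := N.filter fun z => 1 / 2 ≤ ‖g z‖ with hJ
  let Φ : E → E → F := fun z u => g (z + (L : ℝ)⁻¹ • u)
  set Θ := min 1 (2 * t * ε) with hΘdef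
  have hΘ0 : 0 < Θ := lt_min one_pos (by positivity)
  have hΘε : ε ^ 2 ≤ Θ := by
    refine le_min (pow_le_one₀ hε.le hε1.le) ?_
    nlinarith
  have hQ : ε / 8 * (ε / 32) / (8 * ρ) = 64 := by
    rw [hρdef]
    field_simp
    norm_num
  have hdist : ∀ z ∈ J, ∀ w ∈ J,
      InnerProductGeometry.angle (g z) (g w) / Real.pi ≤ Θ := by
    intro z hz w hw
    obtain ⟨hz, hz'⟩ := Finset.mem_filter.1 hz
    obtain ⟨hw, hw'⟩ := Finset.mem_filter.1 hw
    refine le_min ((div_le_one Real.pi_pos).2 (InnerProductGeometry.angle_le_pi _ _)) ?_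
    refine (angle_div_pi_le_norm_sub (by norm_num) hz' hw').trans ?_
    have h1 := hg.dist_le_mul z w
    rw [dist_eq_norm, dist_eq_norm] at h1
    have h2 : ‖z - w‖ ≤ 2 * r := (norm_sub_le _ _).trans (by linarith [hN1 z hz, hN1 w hw])
    have h3 : 2 * t * ε = L * (2 * r) := by
      rw [htdef]
      field_simp
    rw [h3]
    norm_num
    exact h1.trans (mul_le_mul_of_nonneg_left h2 hL'.le)
  have hmain := pi_exists_charts_lt_angle (J := J) (P := J ×ˢ J) (Φ := Φ) (κ := ε / 32)
    (a := ε / 8) (b := ε / 8) (ρ := ρ) (Θ := Θ)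
    (fun z _ => by
      refine LipschitzWith.of_dist_le_mul fun u v => (hg.dist_le_mul _ _).trans ?_
      rw [dist_add_left, dist_smul₀, Real.norm_of_nonneg (by positivity), ← mul_assoc,
        mul_inv_cancel₀ hL'.ne']
      simp)
    (fun p hp => Finset.mem_product.1 hp)
    (fun z hz => by simpa [Φ] using (Finset.mem_filter.1 hz).2)
    (by positivity) (by positivity) (by positivity) hρ
    (fun p hp => by
      simpa [Φ] using hdist p.1 (Finset.mem_product.1 hp).1 p.2 (Finset.mem_product.1 hp).2)
    hm1 (by rw [hQ]; norm_num) (by rw [hQ]; linarith)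
  rw [hQ] at hmain
  have hsub : failureSet g r ε m ⊆ {A | ∃ p ∈ J ×ˢ J, ∃ t t' : E, ‖t‖ ≤ ρ ∧ ‖t'‖ ≤ ρ ∧
        1 / 2 ≤ ‖Φ p.1 t‖ ∧ 1 / 2 ≤ ‖Φ p.2 t'‖ ∧
        signDiff A (Φ p.1 t) (Φ p.2 t') / m + (2 * ρ + 4 * (ε / 32) + ε / 8 + 2 * (ε / 8)) <
          InnerProductGeometry.angle (Φ p.1 t) (Φ p.2 t') / Real.pi} := by
    have hchart : ∀ u : E, ‖u‖ ≤ r → 1 < ‖g u‖ →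
        ∃ z ∈ J, ∃ t : E, ‖t‖ ≤ ρ ∧ Φ z t = g u := by
      intro u hu hgu
      obtain ⟨z, hz, hzu⟩ := hN2 u hu
      refine ⟨z, Finset.mem_filter.2 ⟨hz, ?_⟩, (L : ℝ) • (u - z), ?_, ?_⟩
      · have h1 := hg.dist_le_mul u z
        rw [dist_eq_norm, dist_eq_norm] at h1
        have h2 : ‖g u - g z‖ ≤ ρ := h1.trans (by
          rw [le_div_iff₀ hL'] at hzu
          linarith)
        have h3 := norm_sub_norm_le (g u) (g z)
        linarith
      · rw [norm_smul, Real.norm_of_nonneg hL'.le]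
        rw [le_div_iff₀ hL'] at hzu
        linarith
      · simp [Φ, smul_smul, inv_mul_cancel₀ hL'.ne']
    rintro A ⟨u, v, hu, hv, hgu, hgv, hA⟩
    obtain ⟨z, hz, t, ht, hzt⟩ := hchart u hu hgu
    obtain ⟨w, hw, t', ht', hwt⟩ := hchart v hv hgv
    refine ⟨(z, w), Finset.mem_product.2 ⟨hz, hw⟩, t, t', ht, ht', ?_⟩
    simp only [hzt, hwt]
    refine ⟨by linarith, by linarith, lt_of_le_of_lt ?_ hA⟩
    have h1 : 2 * ρ ≤ ε / 2 := by
      rw [hρdef]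
      nlinarith
    linarith
  refine (measure_mono hsub).trans (hmain.trans (ENNReal.ofReal_le_ofReal ?_))
  set e := Real.exp (-(m * (ε / 8) ^ 2 / (2 * Θ))) with he
  have hJN : (J.card : ℝ) ≤ (1 + 2 ^ 18 * t / ε) ^ s := by
    have h1 : (J.card : ℝ) ≤ N.card := by exact_mod_cast Finset.card_filter_le _ _
    refine h1.trans (hN3.trans_eq ?_)
    congr 2
    rw [htdef, hρdef]
    field_simp
  set M := (1 + 2 ^ 18 * t / ε) ^ s with hM
  have hM1 : 1 ≤ M := one_le_pow₀ (by
    have : 0 ≤ 2 ^ 18 * t / ε := by positivity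
    linarith)
  have he16 : Real.exp (-(m * 64 / 4)) ≤ e := by
    refine Real.exp_le_exp.2 (neg_le_neg ?_)
    rw [div_le_div_iff₀ (by positivity) (by norm_num)]
    have := mul_le_mul_of_nonneg_left hΘε (Nat.cast_nonneg (α := ℝ) m)
    nlinarith
  have hM2 : 2 * M ^ 2 ≤ Real.exp (m * ε ^ 2 / (256 * Θ)) := by
    rw [← Real.log_le_iff_le_exp (by positivity), Real.log_mul (by norm_num) (by positivity),
      Real.log_pow, hM, Real.log_pow]
    have h1 := log_card_net_bound hε hε1 ht1.le hΘ0 (min_le_left _ _) (min_le_right _ _) hl hlt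
    have h2 : Real.log 2 + 2 * (s * Real.log (1 + 2 ^ 18 * t / ε)) ≤
        s * (Real.log 2 + 2 * Real.log (1 + 2 ^ 18 * t / ε)) := by
      have := mul_le_mul_of_nonneg_right hs' (Real.log_pos (by norm_num : (1 : ℝ) < 2)).le
      linarith
    refine (le_of_eq (by norm_num)).trans (h2.trans ?_)
    refine (mul_le_mul_of_nonneg_left h1 (by positivity)).trans ?_
    rw [le_div_iff₀ (by positivity)]
    have h3 : (s : ℝ) * ((31 / l + 4) * Real.log t / Θ) * (256 * Θ) =
        256 * (31 / l + 4) * (s * Real.log t) := by field_simp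
    rw [h3]
    refine (mul_le_mul_of_nonneg_right hC (by positivity)).trans ?_
    have h4 : C * s * (ε ^ 2)⁻¹ * Real.log t = C * (s * Real.log t) / ε ^ 2 := by
      field_simp
    rw [h4, div_le_iff₀ (by positivity)] at hm
    exact hm
  have hJ2 : ((J ×ˢ J).card : ℝ) ≤ M ^ 2 := by
    rw [Finset.card_product, Nat.cast_mul, sq]
    exact mul_le_mul hJN hJN (by positivity) (by positivity)
  calc (J.card : ℝ) * Real.exp (-(m * 64 / 4)) + (J ×ˢ J).card * e
      ≤ M ^ 2 * e + M ^ 2 * e := by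
        refine add_le_add (mul_le_mul (hJN.trans ?_) he16 (by positivity) (by positivity))
          (mul_le_mul_of_nonneg_right hJ2 (Real.exp_nonneg _))
        nlinarith
    _ = 2 * M ^ 2 * e := by ring
    _ ≤ Real.exp (m * ε ^ 2 / (256 * Θ)) * e :=
        mul_le_mul_of_nonneg_right hM2 (Real.exp_nonneg _)
    _ = Real.exp (-(m * ε ^ 2 / (256 * Θ))) := by
        rw [he, ← Real.exp_add]
        congr 1
        field_simp
        ring
    _ ≤ Real.exp (-(m * ε ^ 2 / 256)) := by
        refine Real.exp_le_exp.2 (neg_le_neg ?_)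
        refine div_le_div_of_nonneg_left (by positivity) (by positivity) ?_
        linarith [min_le_left 1 (2 * t * ε)]

end Atlas

section Poles

variable {E P : Type*} [NormedAddCommGroup E] [InnerProductSpace ℝ E]
  [NormedAddCommGroup P] [NormedSpace ℝ P]

/-- A linear map with Hilbert-Schmidt norm at most `M` that nearly attains it at `v` is small on
the orthogonal complement of `v`. -/
lemma norm_map_le_of_inner_eq_zero {W : E →ₗ[ℝ] P} {M l : ℝ} (hM : 0 < M) (hl : 0 ≤ l) {v : E}
    (hW : ∀ q, ‖q‖ ≤ 1 → inner ℝ v q = 0 → ‖W v‖ ^ 2 + ‖W q‖ ^ 2 ≤ M ^ 2)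
    (hWv : M * Real.exp (-l) ≤ ‖W v‖) {q : E} (hq : inner ℝ v q = 0) :
    ‖W q‖ ≤ Real.sqrt (2 * l) * M * ‖q‖ := by
  rcases eq_or_ne q 0 with rfl | hq0
  · simp
  have hqn : 0 < ‖q‖ := norm_pos_iff.2 hq0
  have h1 := hW (‖q‖⁻¹ • q) (by rw [norm_smul, norm_inv, norm_norm, inv_mul_cancel₀ hqn.ne'])
    (by rw [inner_smul_right, hq, mul_zero])
  rw [map_smul, norm_smul, norm_inv, norm_norm] at h1
  have h2 : (M * Real.exp (-l)) ^ 2 ≤ ‖W v‖ ^ 2 := pow_le_pow_left₀ (by positivity) hWv 2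
  have h3 : 1 - 2 * l ≤ Real.exp (-l) ^ 2 := by
    rw [← Real.exp_nat_mul]
    have := Real.add_one_le_exp (((2 : ℕ) : ℝ) * -l)
    push_cast at this ⊢
    linarith
  have h4 : (‖q‖⁻¹ * ‖W q‖) ^ 2 ≤ (Real.sqrt (2 * l) * M) ^ 2 := by
    rw [mul_pow (Real.sqrt _), Real.sq_sqrt (by positivity)]
    have := mul_le_mul_of_nonneg_left h3 (sq_nonneg M)
    rw [mul_pow M] at h2
    linarith
  have h5 := (abs_le_of_sq_le_sq' h4 (by positivity)).2
  rwa [inv_mul_le_iff₀ hqn, mul_comm ‖q‖] at h5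

lemma sq_norm_sub_inner_smul {v y : E} (hv : ‖v‖ = 1) :
    ‖y - inner ℝ v y • v‖ ^ 2 = ‖y‖ ^ 2 - inner ℝ v y ^ 2 := by
  rw [norm_sub_sq_real, inner_smul_right, norm_smul, hv, real_inner_comm v y, Real.norm_eq_abs,
    mul_one, sq_abs]
  rw [real_inner_comm]
  ring

lemma inner_sub_inner_smul {v y : E} (hv : ‖v‖ = 1) : inner ℝ v (y - inner ℝ v y • v) = 0 := by
  rw [inner_sub_right, inner_smul_right, real_inner_self_eq_norm_sq, hv]
  ring

/-- Two points of a ball whose images under `W` are almost as far apart as possible lie near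
opposite poles. -/
lemma near_poles {W : E →ₗ[ℝ] P} {M l r : ℝ} (hM : 0 < M) (hl : 0 ≤ l) (hr : 0 < r) {v : E}
    (hv : ‖v‖ = 1) (hWv : ‖W v‖ ≤ M)
    (hWq : ∀ q, inner ℝ v q = 0 → ‖W q‖ ≤ Real.sqrt (2 * l) * M * ‖q‖)
    {y y' : E} (hy : ‖y‖ ≤ r) (hy' : ‖y'‖ ≤ r) (hsep : 2 * r * (1 - l) * M ≤ ‖W (y - y')‖)
    (hle : inner ℝ v y' ≤ inner ℝ v y) :
    (r - inner ℝ v y) + Real.sqrt (2 * l) * ‖y - inner ℝ v y • v‖ ≤ 20 * l * r ∧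
      (r + inner ℝ v y') + Real.sqrt (2 * l) * ‖y' - inner ℝ v y' • v‖ ≤ 20 * l * r := by
  set β := Real.sqrt (2 * l) with hβ
  have hβ0 : 0 ≤ β := Real.sqrt_nonneg _
  have hβ2 : β ^ 2 = 2 * l := Real.sq_sqrt (by positivity)
  have hq := sq_norm_sub_inner_smul (y := y) hv
  have hq' := sq_norm_sub_inner_smul (y := y') hv
  have hq0 := inner_sub_inner_smul (y := y) hv
  have hq0' := inner_sub_inner_smul (y := y') hv
  have hα := abs_real_inner_le_norm v y
  have hα' := abs_real_inner_le_norm v y'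
  rw [hv, one_mul] at hα hα'
  set α := inner ℝ v y
  set α' := inner ℝ v y'
  set q := y - α • v with hqdef
  set q' := y' - α' • v with hqdef'
  have hdec : W (y - y') = (α - α') • W v + W (q - q') := by
    rw [← map_smul, ← map_add]
    congr 1
    rw [hqdef, hqdef', sub_smul]
    abel
  obtain ⟨hα1, hα2⟩ := abs_le.1 (hα.trans hy)
  obtain ⟨hα1', hα2'⟩ := abs_le.1 (hα'.trans hy')
  have hyr : ‖y‖ ^ 2 ≤ r ^ 2 := pow_le_pow_left₀ (norm_nonneg _) hy 2
  have hyr' : ‖y'‖ ^ 2 ≤ r ^ 2 := pow_le_pow_left₀ (norm_nonneg _) hy' 2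
  have hqb : ‖q‖ ^ 2 ≤ 2 * r * (r - α) := by nlinarith
  have hqb' : ‖q'‖ ^ 2 ≤ 2 * r * (r + α') := by nlinarith
  have h1 : ‖W (y - y')‖ ≤ (α - α') * M + β * M * (‖q‖ + ‖q'‖) := by
    rw [hdec]
    refine (norm_add_le _ _).trans (add_le_add ?_ ?_)
    · rw [norm_smul, Real.norm_of_nonneg (by linarith)]
      exact mul_le_mul_of_nonneg_left hWv (by linarith)
    · refine (hWq _ (by rw [inner_sub_right, hq0, hq0', sub_zero])).trans ?_
      exact mul_le_mul_of_nonneg_left (norm_sub_le _ _) (by positivity)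
  have h2 : 2 * r * (1 - l) ≤ (α - α') + β * (‖q‖ + ‖q'‖) := by
    have h3 := hsep.trans h1
    have h4 : (α - α') * M + β * M * (‖q‖ + ‖q'‖) = ((α - α') + β * (‖q‖ + ‖q'‖)) * M := by ring
    rw [h4] at h3
    exact le_of_mul_le_mul_right h3 hM
  set S := (r - α) + (r + α') with hS
  have hS0 : 0 ≤ S := by linarith
  have hAM : ∀ x u : ℝ, 0 ≤ x → x ^ 2 ≤ 2 * r * u → β * x ≤ 2 * l * r + u / 2 := by
    intro x u hx hxu
    refine (abs_le_of_sq_le_sq' ?_ ?_).2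
    · have h5 : (β * x) ^ 2 ≤ 2 * l * (2 * r * u) := by
        rw [mul_pow, hβ2]
        exact mul_le_mul_of_nonneg_left hxu (by positivity)
      nlinarith [sq_nonneg (2 * l * r - u / 2)]
    · have : 0 ≤ u := by
        by_contra! hu
        have := mul_pos_of_neg_of_neg (by linarith [hr] : -(2 * r) < 0) hu
        nlinarith [sq_nonneg x]
      positivity
  have hSb : S ≤ 12 * l * r := by
    have h3 := hAM _ _ (norm_nonneg q) hqb
    have h4 := hAM _ _ (norm_nonneg q') hqb'
    rw [mul_add] at h2
    linarith
  have hfin : ∀ x u : ℝ, 0 ≤ x → u ≤ 12 * l * r → x ^ 2 ≤ 2 * r * u → β * x ≤ 7 * l * r := by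
    intro x u hx hu hxu
    refine (abs_le_of_sq_le_sq' ?_ (by positivity)).2
    rw [mul_pow, hβ2]
    have h5 : 2 * l * x ^ 2 ≤ 2 * l * (2 * r * (12 * l * r)) :=
      mul_le_mul_of_nonneg_left (hxu.trans (mul_le_mul_of_nonneg_left hu (by positivity)))
        (by positivity)
    have h6 : (7 * l * r) ^ 2 = 2 * l * (2 * r * (12 * l * r)) + (l * r) ^ 2 := by ring
    rw [h6]
    exact h5.trans (le_add_of_nonneg_right (sq_nonneg _))
  have hlr : 0 ≤ l * r := by positivity
  have h6 := hfin _ _ (norm_nonneg q) (by linarith) hqb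
  have h7 := hfin _ _ (norm_nonneg q') (by linarith) hqb'
  constructor <;> linarith

end Poles

section TwoCharts

lemma half_le_of_sin_lt {ε t : ℝ} (hε : 0 < ε) (ht : t ≤ 11 / 10)
    (h : Real.sin (Real.pi * ε / 2) < t * ε) : 1 / 2 ≤ ε := by
  by_contra! hlt
  have h1 := Real.pi_gt_three
  have h2 := Real.pi_lt_d2
  have hx0 : 0 < Real.pi * ε / 2 := by positivity
  have hx1 : Real.pi * ε / 2 ≤ 0.79 := by nlinarith
  have h3 := Real.sin_gt_sub_cube hx0
  set x := Real.pi * ε / 2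
  have h4 : x ^ 3 / 6 ≤ x * (0.79 ^ 2 / 6) := by
    have : x ^ 2 ≤ 0.79 ^ 2 := pow_le_pow_left₀ hx0.le hx1 2
    nlinarith
  have h5 : 3 / 2 * ε ≤ x := by
    change 3 / 2 * ε ≤ Real.pi * ε / 2
    nlinarith
  have h6 : t * ε ≤ 11 / 10 * ε := mul_le_mul_of_nonneg_right ht hε.le
  norm_num at h4
  linarith

/-- The chord between two vectors of norm at least one is at least that of the unit sphere. -/
lemma two_mul_sin_half_angle_le {F : Type*} [NormedAddCommGroup F] [InnerProductSpace ℝ F]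
    {x y : F} (hx : 1 ≤ ‖x‖) (hy : 1 ≤ ‖y‖) :
    2 * Real.sin (InnerProductGeometry.angle x y / 2) ≤ ‖x - y‖ := by
  set θ := InnerProductGeometry.angle x y
  have hcos := InnerProductGeometry.cos_angle_mul_norm_mul_norm x y
  have hsq : Real.sin (θ / 2) ^ 2 = 1 / 2 - Real.cos θ / 2 := by
    rw [Real.sin_sq_eq_half_sub]
    congr 3
    ring
  refine (abs_le_of_sq_le_sq' ?_ (norm_nonneg _)).2
  have h3 : ‖x - y‖ ^ 2 = (‖x‖ - ‖y‖) ^ 2 + 4 * (‖x‖ * ‖y‖) * Real.sin (θ / 2) ^ 2 := by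
    rw [norm_sub_sq_real, ← hcos, hsq]
    ring
  have h4 : 1 * Real.sin (θ / 2) ^ 2 ≤ ‖x‖ * ‖y‖ * Real.sin (θ / 2) ^ 2 :=
    mul_le_mul_of_nonneg_right (one_le_mul_of_one_le_of_one_le hx hy) (sq_nonneg _)
  rw [h3, mul_pow]
  nlinarith [sq_nonneg (‖x‖ - ‖y‖)]

variable {E P F : Type*} [NormedAddCommGroup E] [InnerProductSpace ℝ E] [FiniteDimensional ℝ E]
  [NormedAddCommGroup P] [NormedSpace ℝ P]
  [NormedAddCommGroup F] [InnerProductSpace ℝ F] [FiniteDimensional ℝ F] [MeasurableSpace F]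
  [BorelSpace F]

open Module in
/-- When the effective Lipschitz constant is close to one, far-apart signals come from two small
regions near opposite poles of the latent ball, and two charts suffice. -/
lemma pi_failureSet_le_of_log_le {g : E → F} {W : E →ₗ[ℝ] P} {K M r ε l : ℝ} (hK : 0 < K)
    (hM : 0 < M) (hg : ∀ z z', ‖g z - g z'‖ ≤ K * ‖W (z - z')‖)
    (hW : ∀ v q, ‖v‖ = 1 → ‖q‖ ≤ 1 → inner ℝ v q = 0 → ‖W v‖ ^ 2 + ‖W q‖ ^ 2 ≤ M ^ 2)
    (hr : 0 < r) (hε : 0 < ε) (hε1 : ε < 1) (hl : l = Real.log (K * M * r / ε)) (hl0 : 0 < l)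
    (hl1 : l ≤ 1 / 41943040) {m : ℕ} (hm : 1 ≤ m)
    (hs : (finrank ℝ E : ℝ) * (10485760 * l) ≤ m) :
    (Measure.pi fun _ : Fin m => stdGaussian F) (failureSet g r ε m) ≤
      ENNReal.ofReal (Real.exp (-(m / 1024))) := by
  classical
  by_cases hbad : ∃ u v : E, ‖u‖ ≤ r ∧ ‖v‖ ≤ r ∧ 1 < ‖g u‖ ∧ 1 < ‖g v‖ ∧
    ε < InnerProductGeometry.angle (g u) (g v) / Real.pi
  swap
  · have : failureSet g r ε m = ∅ := by
      refine Set.eq_empty_iff_forall_notMem.2 ?_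
      rintro A ⟨u, v, h1, h2, h3, h4, h5⟩
      refine hbad ⟨u, v, h1, h2, h3, h4, lt_of_le_of_lt ?_ h5⟩
      exact le_add_of_nonneg_left (by positivity)
    simp [this]
  have hpi := Real.pi_pos
  set t := K * M * r / ε with ht
  have ht0 : 0 < t := by positivity
  have htexp : t = Real.exp l := by rw [hl, Real.exp_log ht0]
  have hKMr : K * M * r = t * ε := by rw [ht]; field_simp
  have ht11 : t ≤ 11 / 10 := by
    rw [htexp]
    have h1 := Real.add_one_le_exp (-l)
    have h2 : Real.exp l * Real.exp (-l) = 1 := by rw [← Real.exp_add]; simp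
    have h3 := Real.exp_pos l
    nlinarith
  have hgap : ∀ u v : E, ‖u‖ ≤ r → ‖v‖ ≤ r → 1 < ‖g u‖ → 1 < ‖g v‖ →
      ε < InnerProductGeometry.angle (g u) (g v) / Real.pi →
      2 * r * Real.exp (-l) * M < ‖W (u - v)‖ := by
    intro u v hu hv hgu hgv h
    have h1 := (angle_div_pi_le_norm_sub one_pos hgu.le hgv.le).trans
      (div_le_div_of_nonneg_right (hg u v) (by norm_num))
    have h2 : 2 * ε < K * ‖W (u - v)‖ := by linarith
    have h3 : K * (2 * r * Real.exp (-l) * M) = 2 * ε := by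
      calc _ = 2 * (K * M * r) * Real.exp (-l) := by ring
        _ = 2 * ε * (Real.exp l * Real.exp (-l)) := by rw [hKMr, htexp]; ring
        _ = 2 * ε := by rw [← Real.exp_add]; simp
    rw [← h3] at h2
    exact lt_of_mul_lt_mul_left h2 hK.le
  obtain ⟨z, z', hz, hz', hgz, hgz', hzz'⟩ := hbad
  have hsep0 := hgap z z' hz hz' hgz hgz' hzz'
  have hne : z - z' ≠ 0 := by
    intro h0
    rw [h0, map_zero, norm_zero] at hsep0
    exact absurd hsep0 (not_lt.2 (by positivity))
  have hn0 : 0 < ‖z - z'‖ := norm_pos_iff.2 hne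
  have hn2 : ‖z - z'‖ ≤ 2 * r := (norm_sub_le _ _).trans (by linarith)
  set v := ‖z - z'‖⁻¹ • (z - z') with hvdef
  have hv : ‖v‖ = 1 := by
    rw [hvdef, norm_smul, norm_inv, norm_norm, inv_mul_cancel₀ hn0.ne']
  have hWv1 : ‖W v‖ ≤ M := by
    have := hW v 0 hv (by simp) (by simp)
    simp only [map_zero, norm_zero] at this
    exact (abs_le_of_sq_le_sq' (by linarith) hM.le).2
  have hWzz : ‖W (z - z')‖ = ‖z - z'‖ * ‖W v‖ := by
    rw [hvdef, map_smul, norm_smul, norm_inv, norm_norm, ← mul_assoc, mul_inv_cancel₀ hn0.ne',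
      one_mul]
  have hvz : inner ℝ v z' ≤ inner ℝ v z := by
    have : inner ℝ v (z - z') = ‖z - z'‖ := by
      rw [hvdef, inner_smul_left, real_inner_self_eq_norm_sq]
      simp only [conj_trivial]
      field_simp
    rw [inner_sub_right] at this
    linarith
  clear_value v
  have hWv : M * Real.exp (-l) ≤ ‖W v‖ := by
    rw [hWzz] at hsep0
    have h1 := hsep0.le.trans (mul_le_mul_of_nonneg_right hn2 (norm_nonneg _))
    have h2 : 2 * r * Real.exp (-l) * M = 2 * r * (M * Real.exp (-l)) := by ring
    rw [h2] at h1
    exact le_of_mul_le_mul_left h1 (by positivity)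
  have hWq : ∀ q, inner ℝ v q = 0 → ‖W q‖ ≤ Real.sqrt (2 * l) * M * ‖q‖ := fun q hq =>
    norm_map_le_of_inner_eq_zero hM hl0.le (fun q h1 h2 => hW v q hv h1 h2) hWv hq
  have hε2 : 1 / 2 ≤ ε := by
    refine half_le_of_sin_lt hε ht11 ?_
    have h1 := two_mul_sin_half_angle_le hgz.le hgz'.le
    have h2 : Real.sin (Real.pi * ε / 2) <
        Real.sin (InnerProductGeometry.angle (g z) (g z') / 2) := by
      rw [lt_div_iff₀ hpi] at hzz'
      refine Real.sin_lt_sin_of_lt_of_le_pi_div_two ?_ ?_ ?_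
      · have : 0 < Real.pi * ε := by positivity
        linarith
      · linarith [InnerProductGeometry.angle_le_pi (g z) (g z')]
      · linarith
    have h3 : K * ‖W (z - z')‖ ≤ 2 * (t * ε) := by
      rw [← hKMr, hWzz]
      have := mul_le_mul hn2 hWv1 (norm_nonneg _) (by positivity)
      have := mul_le_mul_of_nonneg_left this hK.le
      linarith
    linarith [hg z z']
  set β := Real.sqrt (2 * l) with hβ
  have hβ0 : 0 < β := Real.sqrt_pos.2 (by positivity)
  set c := (2 * K * M)⁻¹ with hc
  have hc0 : 0 < c := by positivity
  let T : E → E := fun x => c • (inner ℝ v x • v + β⁻¹ • (x - inner ℝ v x • v))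
  have hTsub : ∀ x y, T x - T y = T (x - y) := by
    intro x y
    simp only [T, inner_sub_right, ← smul_sub]
    congr 1
    module
  have hWT : ∀ x, K * ‖W (T x)‖ ≤ ‖x‖ := by
    intro x
    have h1 := abs_real_inner_le_norm v x
    rw [hv, one_mul] at h1
    have h2 := hWq _ (inner_sub_inner_smul (y := x) hv)
    have h3 : ‖x - inner ℝ v x • v‖ ≤ ‖x‖ := by
      refine (abs_le_of_sq_le_sq' ?_ (norm_nonneg _)).2
      rw [sq_norm_sub_inner_smul hv]
      linarith [sq_nonneg (inner ℝ v x)]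
    have h4 : ‖W (T x)‖ ≤ c * (‖x‖ * M + β⁻¹ * (β * M * ‖x‖)) := by
      simp only [T, map_smul, map_add]
      rw [norm_smul, Real.norm_of_nonneg hc0.le]
      refine mul_le_mul_of_nonneg_left ((norm_add_le _ _).trans (add_le_add ?_ ?_)) hc0.le
      · rw [norm_smul]
        exact mul_le_mul h1 hWv1 (norm_nonneg _) (norm_nonneg _)
      · rw [norm_smul, norm_inv, Real.norm_of_nonneg hβ0.le]
        refine mul_le_mul_of_nonneg_left (h2.trans ?_) (by positivity)
        exact mul_le_mul_of_nonneg_left h3 (by positivity)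
    refine (mul_le_mul_of_nonneg_left h4 hK.le).trans_eq ?_
    rw [hc]
    field_simp
    ring
  let Φ : Bool → E → F := fun i x => g ((if i then r else -r) • v + T x)
  have hΦ : ∀ i, LipschitzWith 1 (Φ i) := by
    refine fun i => LipschitzWith.of_dist_le_mul fun x y => ?_
    rw [dist_eq_norm, dist_eq_norm, NNReal.coe_one, one_mul]
    refine (hg _ _).trans ?_
    rw [add_sub_add_left_eq_sub, hTsub]
    exact hWT _
  have hT0 : T 0 = 0 := by simp [T]
  have hTsurj : ∀ y : E, ∀ d : ℝ, |inner ℝ v y - d| + β * ‖y - inner ℝ v y • v‖ ≤ 20 * l * r →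
      ∃ x, ‖x‖ ≤ 80 * l ∧ d • v + T x = y := by
    intro y d hyd
    refine ⟨c⁻¹ • ((inner ℝ v y - d) • v + β • (y - inner ℝ v y • v)), ?_, ?_⟩
    · rw [norm_smul, norm_inv, Real.norm_of_nonneg hc0.le]
      have h1 : ‖(inner ℝ v y - d) • v + β • (y - inner ℝ v y • v)‖ ≤ 20 * l * r := by
        refine (norm_add_le _ _).trans (le_trans (le_of_eq ?_) hyd)
        rw [norm_smul, norm_smul, hv, mul_one, Real.norm_eq_abs, Real.norm_of_nonneg hβ0.le]
      refine (mul_le_mul_of_nonneg_left h1 (by positivity)).trans ?_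
      rw [hc, inv_inv]
      have h2 : t * ε ≤ 2 := by nlinarith
      calc _ = 40 * l * (K * M * r) := by ring
        _ ≤ 40 * l * 2 := by rw [hKMr]; gcongr
        _ = 80 * l := by ring
    · have h1 : inner ℝ v (c⁻¹ • ((inner ℝ v y - d) • v + β • (y - inner ℝ v y • v))) =
          c⁻¹ * (inner ℝ v y - d) := by
        rw [inner_smul_right, inner_add_right, inner_smul_right, inner_smul_right,
          inner_sub_inner_smul hv, real_inner_self_eq_norm_sq, hv]
        ring
      simp only [T, h1]
      have h2 : c⁻¹ • ((inner ℝ v y - d) • v + β • (y - inner ℝ v y • v)) -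
          (c⁻¹ * (inner ℝ v y - d)) • v = (c⁻¹ * β) • (y - inner ℝ v y • v) := by
        module
      rw [h2, smul_smul, smul_add, smul_smul, smul_smul]
      have h3 : c * (c⁻¹ * (inner ℝ v y - d)) = inner ℝ v y - d := by field_simp
      have h4 : c * (β⁻¹ * (c⁻¹ * β)) = 1 := by field_simp
      rw [h3, h4]
      module
  have hsep : ∀ u w : E, ‖u‖ ≤ r → ‖w‖ ≤ r → 1 < ‖g u‖ → 1 < ‖g w‖ →
      ε < InnerProductGeometry.angle (g u) (g w) / Real.pi → inner ℝ v w ≤ inner ℝ v u →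
      (∃ x, ‖x‖ ≤ 80 * l ∧ Φ true x = g u) ∧ ∃ x, ‖x‖ ≤ 80 * l ∧ Φ false x = g w := by
    intro u w hu hw hgu hgw h hle
    have h1 : 2 * r * (1 - l) * M ≤ ‖W (u - w)‖ := by
      refine le_trans ?_ (hgap u w hu hw hgu hgw h).le
      have := Real.add_one_le_exp (-l)
      gcongr
      linarith
    obtain ⟨h2, h3⟩ := near_poles hM hl0.le hr hv hWv1 hWq hu hw h1 hle
    have h4 := (abs_le.1 (abs_real_inner_le_norm v u)).2
    have h5 := (abs_le.1 (abs_real_inner_le_norm v w)).1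
    rw [hv, one_mul] at h4 h5
    constructor
    · obtain ⟨x, hx, hxu⟩ := hTsurj u r (by
        rw [abs_sub_comm, abs_of_nonneg (by linarith)]; exact h2)
      exact ⟨x, hx, by simp [Φ, hxu]⟩
    · obtain ⟨x, hx, hxw⟩ := hTsurj w (-r) (by
        rw [abs_of_nonneg (by linarith), sub_neg_eq_add, add_comm (inner ℝ v w)]; exact h3)
      exact ⟨x, hx, by simp only [Φ, Bool.false_eq_true, if_false, hxw]⟩
  obtain ⟨⟨x, hx, hxz⟩, ⟨x', hx', hxz'⟩⟩ := hsep z z' hz hz' hgz hgz' hzz' hvz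
  have hΦ0 : ∀ i, 1 / 2 ≤ ‖Φ i 0‖ := by
    have key : ∀ i (x : E) (y : F), ‖x‖ ≤ 80 * l → Φ i x = y → 1 < ‖y‖ → 1 / 2 ≤ ‖Φ i 0‖ := by
      rintro i x y hx rfl hy
      have h1 := (hΦ i).dist_le_mul x 0
      rw [dist_eq_norm, dist_eq_norm, NNReal.coe_one, one_mul, sub_zero] at h1
      have h2 := norm_sub_norm_le (Φ i x) (Φ i 0)
      linarith
    rintro (_ | _)
    · exact key _ _ _ hx' hxz' hgz'
    · exact key _ _ _ hx hxz hgz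
  have hm' : (1 : ℝ) ≤ m := by exact_mod_cast hm
  have hQ : (1 / 16 * (1 / 64) / (8 * (80 * l)) : ℝ) = 1 / (655360 * l) := by
    field_simp
    norm_num
  have hQ64 : (64 : ℝ) ≤ 1 / (655360 * l) := by
    rw [le_div_iff₀ (by positivity)]
    linarith
  have hmain := pi_exists_charts_lt_angle (J := Finset.univ) (P := {(true, false)}) (Φ := Φ)
    (κ := 1 / 64) (a := 1 / 16) (b := 1 / 16) (ρ := 80 * l) (Θ := 1) (m := m)
    (fun j _ => hΦ j) (fun p _ => ⟨Finset.mem_univ _, Finset.mem_univ _⟩) (fun j _ => hΦ0 j)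
    (by norm_num) (by norm_num) (by norm_num) (by positivity)
    (fun p _ => (div_le_one hpi).2 (InnerProductGeometry.angle_le_pi _ _)) hm
    (by rw [hQ]; linarith)
    (by
      rw [hQ, mul_one_div, div_div, le_div_iff₀ (by positivity)]
      linarith)
  rw [hQ] at hmain
  refine (measure_mono ?_).trans (hmain.trans (ENNReal.ofReal_le_ofReal ?_))
  · rintro A ⟨u, w, hu, hw, hgu, hgw, hA⟩
    have hang : ε < InnerProductGeometry.angle (g u) (g w) / Real.pi :=
      lt_of_le_of_lt (le_add_of_nonneg_left (by positivity)) hA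
    have hbudget : 2 * (80 * l) + 4 * (1 / 64) + 1 / 16 + 2 * (1 / 16) ≤ ε := by linarith
    refine ⟨(true, false), Finset.mem_singleton_self _, ?_⟩
    rcases le_total (inner ℝ v w) (inner ℝ v u) with hle | hle
    · obtain ⟨⟨x, hx, hxu⟩, ⟨x', hx', hxw⟩⟩ := hsep u w hu hw hgu hgw hang hle
      refine ⟨x, x', hx, hx', ?_⟩
      simp only [hxu, hxw]
      exact ⟨by linarith, by linarith, by linarith⟩
    · rw [InnerProductGeometry.angle_comm] at hang hA
      rw [signDiff_comm] at hA
      obtain ⟨⟨x, hx, hxu⟩, ⟨x', hx', hxw⟩⟩ := hsep w u hw hu hgw hgu hang hle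
      refine ⟨x, x', hx, hx', ?_⟩
      simp only [hxu, hxw]
      exact ⟨by linarith, by linarith, by linarith⟩
  · set e := Real.exp (-((m : ℝ) / 1024)) with he
    have he1 : e ≤ 1024 / 1025 := by
      have h1 : e ≤ Real.exp (-(1 / 1024)) := Real.exp_le_exp.2 (by linarith)
      refine h1.trans ?_
      rw [Real.exp_neg, inv_le_comm₀ (Real.exp_pos _) (by norm_num)]
      linarith [Real.add_one_le_exp (1 / 1024 : ℝ)]
    have h15 : Real.exp (-15) ≤ 1 / 2 ^ 15 := by
      have h1 : Real.exp (-15) = Real.exp (-1) ^ 15 := by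
        rw [← Real.exp_nat_mul]
        norm_num
      rw [h1, ← one_div_pow]
      refine pow_le_pow_left₀ (Real.exp_nonneg _) ?_ _
      rw [Real.exp_neg, ← one_div]
      exact one_div_le_one_div_of_le (by norm_num) (by linarith [Real.add_one_le_exp (1 : ℝ)])
    have h1 : Real.exp (-(m * (1 / (655360 * l)) / 4)) ≤ e * Real.exp (-15) := by
      rw [he, ← Real.exp_add]
      refine Real.exp_le_exp.2 ?_
      have := mul_le_mul_of_nonneg_left hQ64 (by linarith : (0 : ℝ) ≤ m)
      linarith
    have h2 : Real.exp (-(m * (1 / 16) ^ 2 / (2 * 1))) = e * e := by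
      rw [he, ← Real.exp_add]
      congr 1
      ring
    have he0 : 0 < e := Real.exp_pos _
    rw [h2]
    simp only [Finset.card_univ, Fintype.card_bool, Finset.card_singleton]
    push_cast
    have h3 : e * (2 * Real.exp (-15) + e) ≤ e * 1 :=
      mul_le_mul_of_nonneg_left (by norm_num at h15; linarith) he0.le
    linarith

end TwoCharts

section Assembly

variable {E P F : Type*} [NormedAddCommGroup E] [InnerProductSpace ℝ E] [FiniteDimensional ℝ E]
  [NormedAddCommGroup P] [NormedSpace ℝ P]
  [NormedAddCommGroup F] [InnerProductSpace ℝ F] [FiniteDimensional ℝ F] [MeasurableSpace F]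
  [BorelSpace F]

omit [InnerProductSpace ℝ E] [FiniteDimensional ℝ E] [FiniteDimensional ℝ F] [MeasurableSpace F]
  [BorelSpace F] in
lemma failureSet_eq_empty {g : E → F} {r ε : ℝ} (m : ℕ)
    (h : ∀ u v : E, ‖u‖ ≤ r → ‖v‖ ≤ r → 1 < ‖g u‖ → 1 < ‖g v‖ →
      InnerProductGeometry.angle (g u) (g v) / Real.pi ≤ ε) :
    failureSet g r ε m = ∅ := by
  refine Set.eq_empty_iff_forall_notMem.2 ?_
  rintro A ⟨u, v, h1, h2, h3, h4, h5⟩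
  refine (lt_of_le_of_lt ?_ h5).not_ge (h u v h1 h2 h3 h4)
  exact le_add_of_nonneg_left (by positivity)

omit [InnerProductSpace ℝ E] [FiniteDimensional ℝ E] [FiniteDimensional ℝ F] [MeasurableSpace F]
  [BorelSpace F] in
lemma failureSet_eq_empty_of_const {g : E → F} {r ε : ℝ} (hε : 0 ≤ ε) (m : ℕ)
    (h : ∀ u v : E, g u = g v) : failureSet g r ε m = ∅ := by
  refine failureSet_eq_empty m fun u v _ _ h1 _ => ?_
  rw [h v u, InnerProductGeometry.angle_self (norm_pos_iff.1 (by linarith))]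
  simpa using hε

open Module in
/-- Failure probability for a Lipschitz function of a linear map with bounded Hilbert-Schmidt
norm. -/
lemma pi_failureSet_le {g : E → F} {W : E →ₗ[ℝ] P} {K M r ε : ℝ} (hK : 0 ≤ K)
    (hM : 0 ≤ M) (hg : ∀ z z', ‖g z - g z'‖ ≤ K * ‖W (z - z')‖)
    (hW : ∀ v q, ‖v‖ = 1 → ‖q‖ ≤ 1 → inner ℝ v q = 0 → ‖W v‖ ^ 2 + ‖W q‖ ^ 2 ≤ M ^ 2)
    (hr : 0 < r) (hε : 0 < ε) (hε1 : ε < 1) {m : ℕ}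
    (hm : 10 ^ 12 * (finrank ℝ E : ℝ) * (ε ^ 2)⁻¹ * Real.log (K * M * r / ε) ≤ m) :
    (Measure.pi fun _ : Fin m => stdGaussian F) (failureSet g r ε m) ≤
      ENNReal.ofReal (Real.exp (-(1 / 1024 * ε ^ 2 * m))) := by
  have hWM : ∀ z, ‖W z‖ ≤ M * ‖z‖ := by
    intro z
    rcases eq_or_ne z 0 with rfl | hz
    · simp
    have hz0 : 0 < ‖z‖ := norm_pos_iff.2 hz
    have h1 := hW (‖z‖⁻¹ • z) 0 (by rw [norm_smul, norm_inv, norm_norm, inv_mul_cancel₀ hz0.ne'])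
      (by simp) (by simp)
    rw [map_smul, norm_smul, norm_inv, norm_norm, map_zero, norm_zero] at h1
    have h2 : ‖z‖⁻¹ * ‖W z‖ ≤ M := (abs_le_of_sq_le_sq' (by linarith) hM).2
    rwa [inv_mul_le_iff₀ hz0, mul_comm] at h2
  have hlip : ∀ z z', ‖g z - g z'‖ ≤ K * M * ‖z - z'‖ := fun z z' =>
    (hg z z').trans ((mul_le_mul_of_nonneg_left (hWM _) hK).trans_eq (by ring))
  have hconst : (∀ u v : E, ‖g u - g v‖ ≤ 0) →
      (Measure.pi fun _ : Fin m => stdGaussian F) (failureSet g r ε m) ≤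
      ENNReal.ofReal (Real.exp (-(1 / 1024 * ε ^ 2 * m))) := by
    intro h
    rw [failureSet_eq_empty_of_const hε.le m fun u v => sub_eq_zero.1 (norm_le_zero_iff.1 (h u v))]
    simp
  rcases hK.eq_or_lt with rfl | hK
  · exact hconst fun u v => by simpa using hlip u v
  rcases hM.eq_or_lt with rfl | hM
  · exact hconst fun u v => by simpa using hlip u v
  rcases Nat.eq_zero_or_pos (finrank ℝ E) with hs | hs
  · have := finrank_zero_iff.1 hs
    exact hconst fun u v => by simp [Subsingleton.elim u v]
  rcases Nat.eq_zero_or_pos m with rfl | hm0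
  · simpa using prob_le_one
  set l := Real.log (K * M * r / ε) with hl
  have hm' : (1 : ℝ) ≤ m := by exact_mod_cast hm0
  have hs' : (1 : ℝ) ≤ finrank ℝ E := by exact_mod_cast hs
  rcases le_or_gt l 0 with hl0 | hl0
  · have ht : K * M * r ≤ ε := by
      have h1 := (Real.log_nonpos_iff (by positivity)).1 hl0
      rwa [div_le_one hε] at h1
    rw [failureSet_eq_empty m]
    · simp
    · intro u v hu hv hgu hgv
      refine (angle_div_pi_le_norm_sub one_pos hgu.le hgv.le).trans ?_
      have h1 : ‖u - v‖ ≤ 2 * r := (norm_sub_le _ _).trans (by linarith)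
      have h2 := (hlip u v).trans (mul_le_mul_of_nonneg_left h1 (by positivity))
      linarith
  rcases le_or_gt l (1 / 41943040) with hl1 | hl1
  · refine (pi_failureSet_le_of_log_le hK hM hg hW hr hε hε1 hl hl0 hl1 hm0 ?_).trans
      (ENNReal.ofReal_le_ofReal (Real.exp_le_exp.2 (neg_le_neg ?_)))
    · refine le_trans ?_ hm
      have h1 : (1 : ℝ) ≤ (ε ^ 2)⁻¹ :=
        (one_le_inv₀ (by positivity)).2 (pow_le_one₀ hε.le hε1.le)
      have h2 : (finrank ℝ E : ℝ) * l * 1 ≤ finrank ℝ E * l * (ε ^ 2)⁻¹ :=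
        mul_le_mul_of_nonneg_left h1 (by positivity)
      have h3 : 0 ≤ (finrank ℝ E : ℝ) * l := by positivity
      linarith
    · have : ε ^ 2 ≤ 1 := pow_le_one₀ hε.le hε1.le
      nlinarith
  · have hKM : 0 < K * M := by positivity
    have hcoe : ((K * M).toNNReal : ℝ) = K * M := Real.coe_toNNReal _ hKM.le
    refine (pi_failureSet_le_of_log_ge (L := (K * M).toNNReal) (l := 1 / 41943040) (C := 10 ^ 12)
      (LipschitzWith.of_dist_le_mul fun u v => ?_) (Real.toNNReal_pos.2 hKM) hr hε hε1
      (by norm_num) ?_ hs (by norm_num) ?_).trans (ENNReal.ofReal_le_ofReal (Real.exp_le_exp.2 (neg_le_neg ?_)))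
    · rw [dist_eq_norm, dist_eq_norm, hcoe]
      exact hlip u v
    · rw [hcoe]
      exact hl1.le
    · rw [hcoe]
      exact hm
    · have : 0 ≤ ε ^ 2 * m := by positivity
      linarith

end Assembly

section Network

lemma evNorm_nonneg {n : ℕ} (x : Fin n → ℝ) : 0 ≤ evNorm x := Real.sqrt_nonneg _

lemma evNorm_sq {n : ℕ} (x : Fin n → ℝ) : evNorm x ^ 2 = ∑ i, x i ^ 2 :=
  Real.sq_sqrt (Finset.sum_nonneg fun _ _ => sq_nonneg _)

lemma evNorm_sum_mul_le {p q : ℕ} {W : Fin q → Fin p → ℝ} {M : ℝ} (hM : 0 ≤ M)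
    (hW : ∑ j, ∑ k, W j k ^ 2 ≤ M ^ 2) (v : Fin p → ℝ) :
    evNorm (fun j => ∑ k, W j k * v k) ≤ M * evNorm v := by
  refine (abs_le_of_sq_le_sq' ?_ (mul_nonneg hM (evNorm_nonneg v))).2
  rw [evNorm_sq, mul_pow, evNorm_sq]
  refine (Finset.sum_le_sum fun j _ => Finset.sum_mul_sq_le_sq_mul_sq _ _ _).trans ?_
  rw [← Finset.sum_mul]
  exact mul_le_mul_of_nonneg_right hW (Finset.sum_nonneg fun i _ => sq_nonneg _)

/-- A layer is constant, or the weights are nonnegatively bounded and it factors through a matrix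
with bounded Frobenius norm. -/
lemma IsLayer.exists_weights {wmax : ℝ} {N p q : ℕ} {φ : (Fin p → ℝ) → (Fin q → ℝ)}
    (h : IsLayer 1 wmax N φ) :
    (∀ v v', φ v = φ v') ∨ 0 ≤ wmax ∧ ∃ W : Fin q → Fin p → ℝ,
      ∑ j, ∑ k, W j k ^ 2 ≤ (N * wmax) ^ 2 ∧
      ∀ v v', evNorm (φ v - φ v') ≤ evNorm (fun j => ∑ k, W j k * (v - v') k) := by
  obtain ⟨hp, hq, W, b, σ, hW, hσ, hφ⟩ := h
  rcases lt_or_ge wmax 0 with hw | hw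
  · left
    intro v v'
    rcases Nat.eq_zero_or_pos p with rfl | hp0
    · rw [Subsingleton.elim v v']
    rcases Nat.eq_zero_or_pos q with rfl | hq0
    · exact Subsingleton.elim _ _
    exact absurd ((abs_nonneg _).trans (hW ⟨0, hq0⟩ ⟨0, hp0⟩)) (not_le.2 hw)
  · refine Or.inr ⟨hw, W, ?_, fun v v' => ?_⟩
    · have h1 : ∀ j k, W j k ^ 2 ≤ wmax ^ 2 := fun j k => sq_le_sq' (abs_le.1 (hW j k)).1
        (abs_le.1 (hW j k)).2
      refine (Finset.sum_le_sum fun j _ => Finset.sum_le_sum fun k _ => h1 j k).trans ?_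
      simp only [Finset.sum_const, Finset.card_univ, Fintype.card_fin, nsmul_eq_mul]
      have h2 : (p : ℝ) ≤ N := by exact_mod_cast hp
      have h3 : (q : ℝ) ≤ N := by exact_mod_cast hq
      rw [mul_pow, ← mul_assoc, sq (N : ℝ)]
      gcongr
    · rw [hφ, hφ]
      refine (hσ _ _).trans_eq ?_
      rw [one_mul]
      congr 1
      ext j
      simp only [Pi.sub_apply, mul_sub, Finset.sum_sub_distrib]
      ring

/-- A network is constant, or it is a Lipschitz function of a matrix with bounded Frobenius norm. -/
lemma IsMLP.exists_weights {wmax : ℝ} {N d s n : ℕ} {G : (Fin s → ℝ) → (Fin n → ℝ)}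
    (h : IsMLP 1 wmax N d s n G) :
    (∀ z z', G z = G z') ∨ 0 ≤ wmax ∧ ∃ (p : ℕ) (W : Fin p → Fin s → ℝ) (K : ℝ), 0 ≤ K ∧
      K * (N * wmax) = (N * wmax) ^ d ∧ ∑ j, ∑ k, W j k ^ 2 ≤ (N * wmax) ^ 2 ∧
      ∀ z z', evNorm (G z - G z') ≤ K * evNorm (fun j => ∑ k, W j k * (z - z') k) := by
  induction h with
  | single h =>
    rcases h.exists_weights with h | ⟨hw, W, hW, h⟩
    · exact Or.inl h
    · exact Or.inr ⟨hw, _, W, 1, zero_le_one, by ring, hW, fun z z' => by simpa using h z z'⟩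
  | comp hG hφ ih =>
    rcases ih with ih | ⟨hw, p, W, K, hK, hKN, hW, ih⟩
    · exact Or.inl fun z z' => congrArg _ (ih z z')
    rcases hφ.exists_weights with h | ⟨-, V, hV, h⟩
    · exact Or.inl fun z z' => h _ _
    have hM : 0 ≤ N * wmax := by positivity
    refine Or.inr ⟨hw, p, W, N * wmax * K, by positivity, ?_, hW, fun z z' => ?_⟩
    · rw [mul_assoc, hKN]
      ring
    · refine (h _ _).trans ((evNorm_sum_mul_le hM hV _).trans ?_)
      exact (mul_le_mul_of_nonneg_left (ih z z') hM).trans_eq (by ring)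

lemma inner_sq_add_inner_sq_le {E : Type*} [NormedAddCommGroup E] [InnerProductSpace ℝ E]
    {v q : E} (hv : ‖v‖ = 1) (hq : ‖q‖ ≤ 1) (hvq : inner ℝ v q = 0) (w : E) :
    inner ℝ w v ^ 2 + inner ℝ w q ^ 2 ≤ ‖w‖ ^ 2 := by
  have h1 : 0 ≤ ‖w - (inner ℝ w v • v + inner ℝ w q • q)‖ ^ 2 := sq_nonneg _
  rw [norm_sub_sq_real, norm_add_sq_real, norm_smul, norm_smul, inner_add_right, inner_smul_right,
    inner_smul_right, inner_smul_left, inner_smul_right, hvq, hv, mul_pow, mul_pow,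
    Real.norm_eq_abs, Real.norm_eq_abs, sq_abs, sq_abs] at h1
  have h2 : ‖q‖ ^ 2 ≤ 1 := pow_le_one₀ (norm_nonneg _) hq
  have h3 := mul_le_mul_of_nonneg_left h2 (sq_nonneg (inner ℝ w q))
  simp only [conj_trivial] at h1
  linarith

end Network

section Recovery

lemma evNorm_eq_norm_toLp {n : ℕ} (x : Fin n → ℝ) : evNorm x = ‖WithLp.toLp 2 x‖ := by
  simp [evNorm, EuclideanSpace.norm_eq]

lemma evInner_eq_inner_toLp {n : ℕ} (x y : Fin n → ℝ) :
    evInner x y = inner ℝ (WithLp.toLp 2 x) (WithLp.toLp 2 y) := by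
  simp [evInner, PiLp.inner_apply, mul_comm]

lemma geodesicDist_eq_angle {n : ℕ} (x y : Fin n → ℝ) {a : ℝ} (ha : 0 < a) :
    geodesicDist x y = InnerProductGeometry.angle (a • WithLp.toLp 2 x) (a • WithLp.toLp 2 y) /
      Real.pi := by
  rw [InnerProductGeometry.angle_smul_left_of_pos _ _ ha,
    InnerProductGeometry.angle_smul_right_of_pos _ _ ha, InnerProductGeometry.angle, geodesicDist,
    evInner_eq_inner_toLp, evNorm_eq_norm_toLp, evNorm_eq_norm_toLp, one_div, inv_mul_eq_div]

lemma sgn_mul_of_pos {a : ℝ} (ha : 0 < a) (p : ℝ) : sgn (a * p) = sgn p := by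
  simp [sgn, mul_pos_iff_of_pos_left ha]

lemma hamDist_triangle {m : ℕ} (u v w : Fin m → ℝ) :
    hamDist u w ≤ hamDist u v + hamDist v w := by
  rw [hamDist, hamDist, hamDist, ← add_div]
  refine div_le_div_of_nonneg_right ?_ (Nat.cast_nonneg m)
  have h : (Finset.univ.filter fun i => u i ≠ w i) ⊆
      (Finset.univ.filter fun i => u i ≠ v i) ∪ (Finset.univ.filter fun i => v i ≠ w i) := by
    intro i
    simp only [Finset.mem_filter, Finset.mem_univ, true_and, Finset.mem_union]
    grind
  exact_mod_cast (Finset.card_le_card h).trans (Finset.card_union_le _ _)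

lemma signDiff_div_eq_hamDist {m n : ℕ} (A : Fin m → Fin n → ℝ) (x y : Fin n → ℝ) {a : ℝ}
    (ha : 0 < a) :
    (signDiff (fun i => WithLp.toLp 2 (A i)) (a • WithLp.toLp 2 x) (a • WithLp.toLp 2 y) : ℝ) / m =
      hamDist (fun i => sgn (evInner (A i) x)) (fun i => sgn (evInner (A i) y)) := by
  simp only [signDiff, hamDist, inner_smul_left, conj_trivial, sgn_mul_of_pos ha,
    evInner_eq_inner_toLp, real_inner_comm]

lemma stdGaussianMatrix_preimage (m n : ℕ) (S : Set (Fin m → EuclideanSpace ℝ (Fin n))) :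
    stdGaussianMatrix m n ((fun A i => WithLp.toLp 2 (A i)) ⁻¹' S) =
      (Measure.pi fun _ : Fin m => stdGaussian (EuclideanSpace ℝ (Fin n))) S := by
  let e : (Fin m → Fin n → ℝ) ≃ᵐ (Fin m → EuclideanSpace ℝ (Fin n)) :=
    MeasurableEquiv.piCongrRight fun _ => MeasurableEquiv.toLp 2 (Fin n → ℝ)
  have : IsProbabilityMeasure (stdGaussianVec n) := by
    unfold stdGaussianVec
    infer_instance
  have h : (stdGaussianMatrix m n).map e =
      Measure.pi fun _ : Fin m => stdGaussian (EuclideanSpace ℝ (Fin n)) := by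
    have h1 := Measure.pi_map_pi (μ := fun _ : Fin m => stdGaussianVec n)
      (f := fun _ => WithLp.toLp 2) fun _ =>
        (MeasurableEquiv.toLp 2 (Fin n → ℝ)).measurable.aemeasurable
    refine h1.trans ?_
    simp only [stdGaussianVec, map_pi_eq_stdGaussian]
  rw [← h, MeasurableEquiv.map_apply]
  rfl

/-- Failure probability for a rescaled neural network. -/
lemma IsMLP.pi_failureSet_le {wmax : ℝ} {N d s n : ℕ} {G : (Fin s → ℝ) → (Fin n → ℝ)}
    (hG : IsMLP 1 wmax N d s n G) {ε R r : ℝ} (hε : 0 < ε) (hε1 : ε < 1) (hR : 0 < R) (hr : 0 < r)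
    {m : ℕ} (hm : 10 ^ 12 * (s : ℝ) * (ε ^ 2)⁻¹ *
      Real.log (r * ((N : ℝ) * wmax) ^ d / (R * ε)) ≤ (m : ℝ)) :
    (Measure.pi fun _ : Fin m => stdGaussian (EuclideanSpace ℝ (Fin n)))
      (failureSet (fun z : EuclideanSpace ℝ (Fin s) => R⁻¹ • WithLp.toLp 2 (G (WithLp.ofLp z)))
        r ε m) ≤ ENNReal.ofReal (Real.exp (-(1 / 1024 * ε ^ 2 * m))) := by
  rcases hG.exists_weights with h | ⟨hw, p, W, K, hK, hKN, hW, h⟩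
  · rw [failureSet_eq_empty_of_const hε.le m fun u v => by rw [h (WithLp.ofLp u) (WithLp.ofLp v)]]
    simp
  have hnorm : ∀ z : EuclideanSpace ℝ (Fin s), ‖(Matrix.of W).toEuclideanLin z‖ =
      evNorm (fun j => ∑ k, W j k * z k) := by
    intro z
    rw [evNorm_eq_norm_toLp]
    congr 1
  refine _root_.pi_failureSet_le (W := (Matrix.of W).toEuclideanLin) (K := R⁻¹ * K)
    (M := N * wmax) (by positivity) (by positivity) (fun z z' => ?_) (fun v q hv hq hvq => ?_)
    hr hε hε1 ?_
  · rw [← smul_sub, norm_smul, Real.norm_of_nonneg (by positivity), mul_assoc, hnorm,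
      ← WithLp.toLp_sub, ← evNorm_eq_norm_toLp]
    exact mul_le_mul_of_nonneg_left (h _ _) (by positivity)
  · rw [hnorm, hnorm, evNorm_sq, evNorm_sq, ← Finset.sum_add_distrib]
    refine (Finset.sum_le_sum fun j _ => ?_).trans hW
    have h1 := inner_sq_add_inner_sq_le hv hq hvq (WithLp.toLp 2 (W j))
    rw [← evNorm_eq_norm_toLp, evNorm_sq] at h1
    simpa [PiLp.inner_apply, mul_comm] using h1
  · rw [finrank_euclideanSpace_fin]
    convert hm using 3
    rw [mul_assoc R⁻¹, hKN]
    field_simp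

end Recovery

/-- Proposition 1 (Liu–Scarlett style uniform recovery guarantee). -/
theorem one_bit_cs_biht_generative :
    ∃ C > (0 : ℝ), ∃ c > (0 : ℝ),
      ∀ (s n d N : ℕ) (wmax : ℝ) (G : (Fin s → ℝ) → (Fin n → ℝ)),
        IsMLP 1 wmax N d s n G →
        ∀ (ε Rmin r τ₁ τ₂ : ℝ), 0 < ε → ε < 1 → 0 < Rmin → 0 < r → 0 ≤ τ₁ → 0 ≤ τ₂ →
        ∀ m : ℕ,
        C * (s : ℝ) * (ε ^ 2)⁻¹ *
            Real.log (r * ((N : ℝ) * wmax) ^ d / (Rmin * ε)) ≤ (m : ℝ) →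
        ENNReal.ofReal (1 - Real.exp (-(c * ε ^ 2 * (m : ℝ)))) ≤
          stdGaussianMatrix m n
            {A | ∀ xstar : Fin n → ℝ,
              (∃ z : Fin s → ℝ, evNorm z ≤ r ∧ G z = xstar) → Rmin < evNorm xstar →
              ∀ y : Fin m → ℝ, (∀ i, y i = 1 ∨ y i = -1) →
                hamDist y (fun i => sgn (evInner (A i) xstar)) ≤ τ₁ →
              ∀ xhat : Fin n → ℝ,
                (∃ z : Fin s → ℝ, evNorm z ≤ r ∧ G z = xhat) → Rmin < evNorm xhat →
                hamDist (fun i => sgn (evInner (A i) xhat)) y ≤ τ₂ →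
                geodesicDist xhat xstar ≤ ε + τ₁ + τ₂} := by
  refine ⟨10 ^ 12, by norm_num, 1 / 1024, by norm_num, ?_⟩
  intro s n d N wmax G hG ε Rmin r τ₁ τ₂ hε hε1 hR hr _ _ m hm
  have hfail := hG.pi_failureSet_le hε hε1 hR hr hm
  rw [← stdGaussianMatrix_preimage] at hfail
  have : IsProbabilityMeasure (stdGaussianMatrix m n) := by
    unfold stdGaussianMatrix stdGaussianVec
    infer_instance
  rw [ENNReal.ofReal_sub _ (Real.exp_pos _).le, ENNReal.ofReal_one, tsub_le_iff_right,
    ← measure_univ (μ := stdGaussianMatrix m n)]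
  refine (measure_mono fun A _ => ?_).trans
    ((measure_union_le _ _).trans (add_le_add le_rfl hfail))
  by_contra hA
  rw [Set.mem_union, not_or] at hA
  refine hA.1 ?_
  rintro _ ⟨z, hz, rfl⟩ hzR y - hy _ ⟨z', hz', rfl⟩ hzR' hy'
  by_contra! hlt
  refine hA.2 ⟨WithLp.toLp 2 z', WithLp.toLp 2 z, ?_, ?_, ?_, ?_, ?_⟩
  · rwa [← evNorm_eq_norm_toLp]
  · rwa [← evNorm_eq_norm_toLp]
  · rwa [norm_smul, norm_inv, Real.norm_of_nonneg hR.le, ← evNorm_eq_norm_toLp,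
      lt_inv_mul_iff₀ hR, mul_one]
  · rwa [norm_smul, norm_inv, Real.norm_of_nonneg hR.le, ← evNorm_eq_norm_toLp,
      lt_inv_mul_iff₀ hR, mul_one]
  · rw [signDiff_div_eq_hamDist A _ _ (inv_pos.2 hR), ← geodesicDist_eq_angle _ _ (inv_pos.2 hR)]
    have := hamDist_triangle (fun i => sgn (evInner (A i) (G z'))) y
      (fun i => sgn (evInner (A i) (G z)))
    linarith
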